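/- arXiv:1408.6968 — 3 statements merged into one kernel-verified Lean document; each statement's English description precedes it below -/
import Mathlib

section
/- For every prime p ≥ 5, the sum of a_p(A,B)⁸ over all pairs (A,B) ∈ (ℤ/pℤ)² with 4A³ + 27B² ≠ 0 equals (14p⁵ - 28p³ - 20p² - 7p - 1)(p - 1). (Equivalently, since there are exactly p² - p such pairs, the eighth moment of a_p is 14p⁴ - 28p² - 20p - 7 - p⁻¹; this is Birch's formula M₈(a_p) = 14p⁴ - 28p² - 20p - 7 - p⁻¹.) -/
section QuadraticCharacterMoments

open Finset Polynomial

section Duality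

theorem AddChar.map_finset_sum {ι A M : Type*} [AddCommMonoid A] [CommMonoid M] (ψ : AddChar A M)
    (s : Finset ι) (f : ι → A) : ψ (∑ i ∈ s, f i) = ∏ i ∈ s, ψ (f i) := by
  classical
  induction s using Finset.induction_on with
  | empty => simp
  | insert a s ha ih => rw [Finset.sum_insert ha, Finset.prod_insert ha, AddChar.map_add_eq_mul, ih]

variable {F : Type*} [Field F]

/-- The polynomial with coefficient vector `c`. -/
noncomputable def vecPoly {n : ℕ} (c : Fin n → F) : F[X] := ∑ i, C (c i) * X ^ (i : ℕ)

theorem eval_vecPoly {n : ℕ} (c : Fin n → F) (x : F) :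
    (vecPoly c).eval x = ∑ i, c i * x ^ (i : ℕ) := by
  simp [vecPoly, eval_finsetSum]

theorem coeff_vecPoly {n : ℕ} (c : Fin n → F) (j : ℕ) :
    (vecPoly c).coeff j = if h : j < n then c ⟨j, h⟩ else 0 := by
  simp only [vecPoly, finsetSum_coeff, coeff_C_mul, coeff_X_pow]
  split_ifs with h
  · rw [Finset.sum_eq_single (⟨j, h⟩ : Fin n)]
    · simp
    · intro b _ hb
      have : j ≠ b := fun e => hb (Fin.ext e.symm)
      simp [this]
    · simp
  · refine Finset.sum_eq_zero fun i _ => ?_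
    have : j ≠ i := fun e => h (e ▸ i.2)
    simp [this]

theorem degree_vecPoly_lt {n : ℕ} (c : Fin n → F) : (vecPoly c).degree < n := by
  rw [degree_lt_iff_coeff_zero]
  intro m hm
  rw [coeff_vecPoly, dif_neg (by omega)]

section LeadSum

variable [Fintype F]

/-- The sum of `Φ` over all functions `x ↦ t x ^ d + ∑ i < d, c i x ^ i`. -/
def leadSum {M : Type*} [AddCommMonoid M] (t : F) (d : ℕ) (Φ : (F → F) → M) : M :=
  ∑ c : Fin d → F, Φ (fun x => t * x ^ d + ∑ i, c i * x ^ (i : ℕ))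

theorem leadSum_zero {M : Type*} [AddCommMonoid M] (t : F) (Φ : (F → F) → M) :
    leadSum t 0 Φ = Φ (fun _ => t) := by
  simp [leadSum]

theorem leadSum_succ {M : Type*} [AddCommMonoid M] (t : F) (d : ℕ) (Φ : (F → F) → M) :
    leadSum t (d + 1) Φ = ∑ a, leadSum t d (fun v => Φ (fun x => a + x * v x)) := by
  simp only [leadSum]
  rw [← (Fin.consEquiv (fun _ : Fin (d + 1) => F)).sum_comp, Fintype.sum_prod_type]
  refine Finset.sum_congr rfl fun a _ => Finset.sum_congr rfl fun c _ => ?_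
  congr 1
  funext x
  simp only [Fin.consEquiv, Equiv.coe_fn_mk, Fin.sum_univ_succ, Fin.cons_zero, Fin.val_zero,
    pow_zero, mul_one, Fin.cons_succ, Fin.val_succ, mul_add, Finset.mul_sum]
  rw [add_left_comm]
  congr 2
  · ring
  · exact Finset.sum_congr rfl fun i _ => by ring

theorem leadSum_zero_succ {M : Type*} [AddCommMonoid M] (d : ℕ) (Φ : (F → F) → M) :
    leadSum 0 (d + 1) Φ = ∑ t, leadSum t d Φ := by
  simp only [leadSum]
  rw [← (Fin.snocEquiv (fun _ : Fin (d + 1) => F)).sum_comp, Fintype.sum_prod_type]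
  refine Finset.sum_congr rfl fun a _ => Finset.sum_congr rfl fun c _ => ?_
  congr 1
  funext x
  simp [Fin.snocEquiv, Fin.sum_univ_castSucc, add_comm]

theorem leadSum_smul {M : Type*} [AddCommMonoid M] {t : F} (ht : t ≠ 0) (d : ℕ)
    (Φ : (F → F) → M) : leadSum t d Φ = leadSum 1 d (fun v => Φ (fun x => t * v x)) := by
  simp only [leadSum]
  refine (Fintype.sum_equiv (Equiv.piCongrRight fun _ : Fin d => Equiv.mulLeft₀ t ht) _ _ ?_).symm
  intro c
  congr 1
  funext x
  simp [mul_add, Finset.mul_sum, mul_assoc]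

end LeadSum

variable [DecidableEq F]

/-- The sum of the values of a polynomial of degree less than `#T` on `T`, weighted by the nodal
weights, is its coefficient of degree `#T - 1`. -/
theorem sum_nodalWeight_mul_eval (T : Finset F) {P : F[X]} (hP : P.degree < #T) :
    ∑ x ∈ T, Lagrange.nodalWeight T id x * P.eval x = P.coeff (#T - 1) := by
  rw [Lagrange.coeff_eq_sum (s := T) (v := id) (Function.injective_id.injOn) hP]
  refine Finset.sum_congr rfl fun x _ => ?_
  simp [Lagrange.nodalWeight, div_eq_mul_inv, mul_comm]

theorem sum_nodalWeight_append {T : Finset F} {m d : ℕ} (hT : #T = m + 1 + d)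
    (c : Fin (m + 1) → F) :
    (∀ i < d, ∑ x ∈ T, Lagrange.nodalWeight T id x * (vecPoly c).eval x * x ^ i = 0) ∧
      ∑ x ∈ T, Lagrange.nodalWeight T id x * (vecPoly c).eval x * x ^ d = c (Fin.last m) := by
  have key : ∀ i ≤ d, ∑ x ∈ T, Lagrange.nodalWeight T id x * (vecPoly c).eval x * x ^ i =
      (vecPoly c * X ^ i).coeff (m + d) := by
    intro i hi
    have := sum_nodalWeight_mul_eval T (P := vecPoly c * X ^ i) (by
      rw [degree_lt_iff_coeff_zero]
      intro k hk
      rw [coeff_mul_X_pow', if_pos (by omega), coeff_vecPoly, dif_neg (by omega)])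
    rw [hT, show m + 1 + d - 1 = m + d by omega] at this
    rw [← this]
    simp [mul_assoc]
  refine ⟨fun i hi => ?_, ?_⟩
  · rw [key i hi.le, coeff_mul_X_pow', if_pos (by omega), coeff_vecPoly, dif_neg (by omega)]
  · rw [key d le_rfl, coeff_mul_X_pow, coeff_vecPoly, dif_pos (by omega)]
    rfl

theorem eq_zero_of_sum_nodalWeight {T : Finset F} {m d : ℕ} (hT : #T = m + d)
    (c : Fin (m + d) → F)
    (h : ∀ i < d, ∑ x ∈ T, Lagrange.nodalWeight T id x * (vecPoly c).eval x * x ^ i = 0)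
    (j : ℕ) (hj : m ≤ j) : (vecPoly c).coeff j = 0 := by
  suffices H : (vecPoly c).degree < m from
    (degree_lt_iff_coeff_zero _ _).1 H j hj
  by_contra hlt
  have h0 : vecPoly c ≠ 0 := by
    rintro h0
    rw [h0, degree_zero] at hlt
    exact hlt (WithBot.bot_lt_coe _)
  have hn : (vecPoly c).natDegree < m + d := by
    rw [natDegree_lt_iff_degree_lt h0]
    exact degree_vecPoly_lt c
  have hm : m ≤ (vecPoly c).natDegree := by
    rw [← not_lt, natDegree_lt_iff_degree_lt h0]
    exact hlt
  set k := (vecPoly c).natDegree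
  have := sum_nodalWeight_mul_eval T (P := vecPoly c * X ^ (m + d - 1 - k)) (by
      rw [degree_lt_iff_coeff_zero]
      intro l hl
      rw [coeff_mul_X_pow', if_pos (by omega)]
      exact coeff_eq_zero_of_natDegree_lt (by omega))
  rw [hT, coeff_mul_X_pow', if_pos (by omega), show m + d - 1 - (m + d - 1 - k) = k by omega] at this
  have h2 := h (m + d - 1 - k) (by omega)
  simp only [eval_mul, eval_pow, eval_X, ← mul_assoc] at this
  rw [h2] at this
  exact h0 (leadingCoeff_eq_zero.1 this.symm)

theorem bijective_nodalWeight_mul_eval {T : Finset F} [Fintype F] {n : ℕ} (hT : #T = n) :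
    Function.Bijective (fun (c : Fin n → F) (x : T) =>
      Lagrange.nodalWeight T id (x : F) * (vecPoly c).eval (x : F)) := by
  rw [Fintype.bijective_iff_injective_and_card]
  refine ⟨fun c c' h => ?_, by simp [hT]⟩
  have hpoly : vecPoly c = vecPoly c' := by
    refine Polynomial.eq_of_degrees_lt_of_eval_finset_eq T ?_ ?_ ?_
    · rw [hT]; exact degree_vecPoly_lt c
    · rw [hT]; exact degree_vecPoly_lt c'
    · intro x hx
      have := congrFun h ⟨x, hx⟩
      exact mul_left_cancel₀ (Lagrange.nodalWeight_ne_zero Function.injective_id.injOn hx) this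
  ext i
  have := congrArg (fun P => P.coeff (i : ℕ)) hpoly
  simpa [coeff_vecPoly] using this

variable [Fintype F]

theorem gaussSum_mul_apply {χ : MulChar F ℂ} (hχ : χ ≠ 1) (hq : χ.IsQuadratic) (ψ : AddChar F ℂ)
    (v : F) : gaussSum χ ψ * χ v = ∑ a, χ a * ψ (a * v) := by
  by_cases hv : v = 0
  · subst hv
    simp [MulChar.sum_eq_zero_of_ne_one hχ, χ.map_zero]
  · have := gaussSum_mulShift_eq χ ψ (Units.mk0 v hv)
    rw [hq.inv, Units.val_mk0, gaussSum] at this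
    rw [mul_comm, ← this]
    simp [AddChar.mulShift_apply, mul_comm]

theorem sum_addChar_linear {ψ : AddChar F ℂ} (hψ : ψ.IsPrimitive) {d : ℕ} (μ : Fin d → F) :
    ∑ c : Fin d → F, ψ (∑ i, c i * μ i) =
      if ∀ i, μ i = 0 then (Fintype.card F : ℂ) ^ d else 0 := by
  have h1 : ∀ c : Fin d → F, ψ (∑ i, c i * μ i) = ∏ i, ψ (c i * μ i) := fun c =>
    AddChar.map_finset_sum ψ _ _
  simp_rw [h1]
  have h2 := (Finset.prod_univ_sum (fun _ : Fin d => (univ : Finset F))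
    (fun i a => ψ (a * μ i)))
  rw [Fintype.piFinset_univ] at h2
  rw [← h2]
  simp_rw [AddChar.sum_mulShift _ hψ]
  split_ifs with h
  · simp [h]
  · push Not at h
    obtain ⟨i, hi⟩ := h
    exact Finset.prod_eq_zero (mem_univ i) (by simp [hi])

/-- Duality: the sum of `∏ x ∈ T, χ (v x)` over monic polynomials `v` of degree `d`, as a sum over
polynomials of degree less than `#T - d`. -/
theorem gaussSum_pow_mul_leadSum {χ : MulChar F ℂ} (hχ : χ ≠ 1) (hq : χ.IsQuadratic)
    {ψ : AddChar F ℂ} (hψ : ψ.IsPrimitive) {T : Finset F} {m d : ℕ} (hT : #T = m + 1 + d) :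
    gaussSum χ ψ ^ (m + 1 + d) * leadSum 1 d (fun v => ∏ x ∈ T, χ (v x)) =
      (Fintype.card F : ℂ) ^ d * (∏ x ∈ T, χ (Lagrange.nodalWeight T id x)) *
        ∑ t, ψ t * leadSum t m (fun v => ∏ x ∈ T, χ (v x)) := by
  set w := Lagrange.nodalWeight T id with hw
  have fourier : ∀ v : F → F, gaussSum χ ψ ^ (m + 1 + d) * ∏ x ∈ T, χ (v x) =
      ∑ c : Fin (m + 1 + d) → F, (∏ x ∈ T, χ (w x * (vecPoly c).eval x)) *
        ψ (∑ x ∈ T, w x * (vecPoly c).eval x * v x) := by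
    intro v
    rw [← hT, ← Finset.prod_const, ← Finset.prod_mul_distrib]
    simp_rw [gaussSum_mul_apply hχ hq]
    rw [← Finset.prod_coe_sort, Finset.prod_univ_sum, Fintype.piFinset_univ]
    rw [hT, ← (bijective_nodalWeight_mul_eval hT).sum_comp]
    refine Finset.sum_congr rfl fun c _ => ?_
    rw [Finset.prod_mul_distrib, ← AddChar.map_finset_sum]
    rw [Finset.prod_coe_sort T (fun x => χ (w x * (vecPoly c).eval x)),
      Finset.sum_coe_sort T (fun x => w x * (vecPoly c).eval x * v x)]
  have inner : ∀ c : Fin (m + 1 + d) → F,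
      ∑ f : Fin d → F, ψ (∑ x ∈ T, w x * (vecPoly c).eval x * (1 * x ^ d + ∑ i, f i * x ^ (i : ℕ)))
      = ψ (∑ x ∈ T, w x * (vecPoly c).eval x * x ^ d) *
        if ∀ i : Fin d, ∑ x ∈ T, w x * (vecPoly c).eval x * x ^ (i : ℕ) = 0
          then (Fintype.card F : ℂ) ^ d else 0 := by
    intro c
    rw [← sum_addChar_linear hψ, Finset.mul_sum]
    refine Finset.sum_congr rfl fun f _ => ?_
    rw [← AddChar.map_add_eq_mul]
    congr 1
    simp_rw [one_mul, mul_add, Finset.sum_add_distrib, Finset.mul_sum]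
    rw [Finset.sum_comm]
    congr 1
    refine Finset.sum_congr rfl fun i _ => Finset.sum_congr rfl fun x _ => ?_
    ring
  have hzero : ∀ (c₁ : Fin (m + 1) → F) (c₂ : Fin d → F),
      (∀ i : Fin d, ∑ x ∈ T, w x * (vecPoly (Fin.append c₁ c₂)).eval x * x ^ (i : ℕ) = 0) →
      c₂ = 0 := by
    intro c₁ c₂ h
    ext j
    have := eq_zero_of_sum_nodalWeight hT (Fin.append c₁ c₂) (fun i hi => h ⟨i, hi⟩) (m + 1 + j)
      (by omega)
    rw [coeff_vecPoly, dif_pos (by omega)] at this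
    have e : (⟨m + 1 + j, by omega⟩ : Fin (m + 1 + d)) = Fin.natAdd (m + 1) j := rfl
    rw [e, Fin.append_right] at this
    exact this
  have happ : ∀ c : Fin (m + 1) → F, vecPoly (Fin.append c (0 : Fin d → F)) = vecPoly c := by
    intro c
    simp [vecPoly, Fin.sum_univ_add]
  rw [leadSum, Finset.mul_sum]
  simp_rw [fourier]
  rw [Finset.sum_comm]
  simp_rw [← Finset.mul_sum, inner]
  rw [← (Fin.appendEquiv (m + 1) d).sum_comp, Fintype.sum_prod_type]
  have step : ∀ c₁ : Fin (m + 1) → F,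
      ∑ c₂ : Fin d → F, (∏ x ∈ T, χ (w x * (vecPoly (Fin.append c₁ c₂)).eval x)) *
        (ψ (∑ x ∈ T, w x * (vecPoly (Fin.append c₁ c₂)).eval x * x ^ d) *
        if ∀ i : Fin d, ∑ x ∈ T, w x * (vecPoly (Fin.append c₁ c₂)).eval x * x ^ (i : ℕ) = 0
          then (Fintype.card F : ℂ) ^ d else 0) =
      (Fintype.card F : ℂ) ^ d * (∏ x ∈ T, χ (w x)) *
        (ψ (c₁ (Fin.last m)) * ∏ x ∈ T, χ ((vecPoly c₁).eval x)) := by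
    intro c₁
    rw [Finset.sum_eq_single 0]
    · rw [happ, if_pos (fun i : Fin d => (sum_nodalWeight_append hT c₁).1 i i.2),
        (sum_nodalWeight_append hT c₁).2]
      simp_rw [map_mul, Finset.prod_mul_distrib]
      ring
    · intro c₂ _ hc
      rw [if_neg (fun h => hc (hzero c₁ c₂ h))]
      simp
    · simp
  refine (Finset.sum_congr rfl fun c₁ _ => step c₁).trans ?_
  rw [← Finset.mul_sum]
  congr 1
  rw [← (Fin.snocEquiv (fun _ : Fin (m + 1) => F)).sum_comp, Fintype.sum_prod_type]
  refine Finset.sum_congr rfl fun t _ => ?_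
  rw [leadSum, Finset.mul_sum]
  refine Finset.sum_congr rfl fun c _ => ?_
  simp [Fin.snocEquiv, eval_vecPoly, Fin.sum_univ_castSucc, add_comm]

section Reciprocity

variable {χ : MulChar F ℂ}

theorem sum_mul_leadSum {T : Finset F} (hT : T.Nonempty) (f : F → ℂ) (m : ℕ) :
    ∑ t, f t * leadSum t m (fun v => ∏ x ∈ T, χ (v x)) =
      f 0 * leadSum 0 m (fun v => ∏ x ∈ T, χ (v x)) +
        (∑ t, f t * χ t ^ #T) * leadSum 1 m (fun v => ∏ x ∈ T, χ (v x)) := by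
  rw [← Finset.add_sum_erase univ _ (mem_univ (0 : F)), Finset.sum_mul,
    ← Finset.add_sum_erase univ (fun t => f t * χ t ^ #T * _) (mem_univ (0 : F))]
  rw [χ.map_zero, zero_pow (by simpa using hT.ne_empty), mul_zero, zero_mul, zero_add]
  congr 1
  refine Finset.sum_congr rfl fun t ht => ?_
  rw [leadSum_smul (Finset.ne_of_mem_erase ht)]
  simp_rw [map_mul, Finset.prod_mul_distrib, Finset.prod_const]
  rw [mul_assoc]
  simp only [leadSum, Finset.mul_sum]

theorem prod_apply_nodalWeight {F : Type*} [Field F] [DecidableEq F] {χ : MulChar F ℂ}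
    (hq : χ.IsQuadratic) (T : Finset F) :
    ∏ x ∈ T, χ (Lagrange.nodalWeight T id x) = χ (-1) ^ (#T).choose 2 := by
  have hinv : ∀ a : F, χ a⁻¹ = χ a := fun a => by
    rw [← MulChar.inv_apply', hq.inv]
  have hsq : ∀ a : F, a ≠ 0 → χ a * χ a = 1 := fun a ha => by
    rcases hq a with h | h | h
    · exact absurd h (ha.isUnit.map χ).ne_zero
    · simp [h]
    · simp [h]
  have h1 : ∀ x, χ (Lagrange.nodalWeight T id x) = ∏ y ∈ T.erase x, χ (x - y) := fun x => by
    simp [Lagrange.nodalWeight, map_prod, hinv]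
  simp_rw [h1]
  clear h1
  induction T using Finset.induction_on with
  | empty => simp
  | insert a T ha ih =>
    rw [Finset.prod_insert ha, Finset.erase_insert ha, Finset.card_insert_of_notMem ha,
      Nat.choose_succ_succ, pow_add, ← ih, Nat.choose_one_right]
    have h2 : ∀ x ∈ T, ∏ y ∈ (insert a T).erase x, χ (x - y) =
        χ (x - a) * ∏ y ∈ T.erase x, χ (x - y) := fun x hx => by
      have hxa : x ≠ a := fun h => ha (h ▸ hx)
      rw [Finset.erase_insert_of_ne hxa.symm,
        Finset.prod_insert (fun h => ha (Finset.mem_of_mem_erase h))]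
    rw [Finset.prod_congr rfl h2, Finset.prod_mul_distrib, ← mul_assoc, ← Finset.prod_mul_distrib]
    congr 1
    rw [← Finset.prod_const]
    refine Finset.prod_congr rfl fun x hx => ?_
    have hxa : a - x ≠ 0 := sub_ne_zero.2 fun h => ha (h ▸ hx)
    rw [show x - a = -1 * (a - x) by ring, map_mul, mul_left_comm, hsq _ hxa, mul_one]

theorem leadSum_reciprocity_odd (hχ : χ ≠ 1) (hq : χ.IsQuadratic) {ψ : AddChar F ℂ}
    (hψ : ψ.IsPrimitive) {T : Finset F} {m d k : ℕ} (hT : #T = m + 1 + d) (hk : #T = 2 * k + 1) :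
    (Fintype.card F : ℂ) ^ (k + 1) * leadSum 1 d (fun v => ∏ x ∈ T, χ (v x)) =
      (Fintype.card F : ℂ) ^ (d + 1) * leadSum 1 m (fun v => ∏ x ∈ T, χ (v x)) := by
  have hne : T.Nonempty := Finset.card_pos.1 (by omega)
  have hpow : ∀ t, χ t ^ #T = χ t := fun t => by
    rw [hk]
    rcases hq t with h | h | h <;> simp [h, pow_succ, pow_mul]
  have hzero : ∀ j, leadSum 0 j (fun v => ∏ x ∈ T, χ (v x)) = 0 := by
    intro j
    induction j with
    | zero =>
      rw [leadSum_zero, Finset.prod_const, χ.map_zero, zero_pow (by omega)]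
    | succ j ih =>
      rw [leadSum_zero_succ]
      have := sum_mul_leadSum (χ := χ) hne (fun _ => 1) j
      simp only [one_mul, hpow, MulChar.sum_eq_zero_of_ne_one hχ, zero_mul, ih, add_zero] at this
      exact this
  have hG := gaussSum_sq hχ hq hψ
  have h := gaussSum_pow_mul_leadSum hχ hq hψ hT
  rw [sum_mul_leadSum hne, hzero, mul_zero, zero_add] at h
  simp_rw [hpow] at h
  rw [show ∑ t, ψ t * χ t = gaussSum χ ψ by simp [gaussSum, mul_comm],
    prod_apply_nodalWeight hq, ← hT] at h
  have h' := congrArg (fun z => gaussSum χ ψ * z) h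
  have hchoose : (#T).choose 2 = k * (2 * k + 1) := by
    rw [hk, Nat.choose_two_right, Nat.add_sub_cancel,
      show (2 * k + 1) * (2 * k) = (k * (2 * k + 1)) * 2 by ring, Nat.mul_div_cancel _ two_pos]
  have hs : χ (-1) ^ 2 = 1 := by
    rw [← map_pow]; simp
  have hsign : χ (-1) ^ (k * (2 * k + 1)) = χ (-1) ^ k := by
    rw [show k * (2 * k + 1) = 2 * (k * k) + k by ring, pow_add, pow_mul, hs, one_pow, one_mul]
  have hs' : χ (-1) ^ (k + 1) * χ (-1) ^ (k + 1) = 1 := by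
    rw [← pow_add, ← two_mul, pow_mul, hs, one_pow]
  rw [← mul_assoc, ← pow_succ', hchoose, hsign, hk,
    show 2 * k + 1 + 1 = 2 * (k + 1) by ring, pow_mul, hG, mul_pow] at h'
  have h'' := congrArg (fun z => χ (-1) ^ (k + 1) * z) h'
  calc _ = (χ (-1) ^ (k + 1) * χ (-1) ^ (k + 1)) * ((Fintype.card F : ℂ) ^ (k + 1) *
        leadSum 1 d (fun v => ∏ x ∈ T, χ (v x))) := by rw [hs', one_mul]
    _ = χ (-1) ^ (k + 1) * (gaussSum χ ψ * ((Fintype.card F : ℂ) ^ d * χ (-1) ^ k *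
        (gaussSum χ ψ * leadSum 1 m (fun v => ∏ x ∈ T, χ (v x))))) := by rw [← h'']; ring
    _ = χ (-1) ^ (k + 1) * χ (-1) ^ k * (Fintype.card F : ℂ) ^ d * gaussSum χ ψ ^ 2 *
        leadSum 1 m (fun v => ∏ x ∈ T, χ (v x)) := by ring
    _ = (χ (-1) ^ (k + 1) * χ (-1) ^ (k + 1)) * ((Fintype.card F : ℂ) ^ (d + 1) *
        leadSum 1 m (fun v => ∏ x ∈ T, χ (v x))) := by rw [hG]; ring
    _ = _ := by rw [hs', one_mul]

theorem leadSum_reciprocity_even (hχ : χ ≠ 1) (hq : χ.IsQuadratic) {ψ : AddChar F ℂ}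
    (hψ : ψ.IsPrimitive) {T : Finset F} {m d k : ℕ} (hT : #T = m + 1 + d) (hk : #T = 2 * k) :
    (Fintype.card F : ℂ) ^ k * leadSum 1 d (fun v => ∏ x ∈ T, χ (v x)) =
      (Fintype.card F : ℂ) ^ d * (leadSum 0 m (fun v => ∏ x ∈ T, χ (v x)) -
        leadSum 1 m (fun v => ∏ x ∈ T, χ (v x))) := by
  have hne : T.Nonempty := Finset.card_pos.1 (by omega)
  have hpow : ∀ t, t ≠ 0 → χ t ^ #T = 1 := fun t ht => by
    rw [hk]
    rcases hq t with h | h | h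
    · exact absurd h (ht.isUnit.map χ).ne_zero
    · simp [h]
    · simp [h]
  have hG := gaussSum_sq hχ hq hψ
  have h := gaussSum_pow_mul_leadSum hχ hq hψ hT
  have hsum : ∑ t, ψ t * χ t ^ #T = -1 := by
    have h1 : ∑ t, ψ t = 0 := AddChar.sum_eq_zero_of_ne_one (by
      rintro rfl
      exact (hψ one_ne_zero) (by ext; simp))
    rw [← Finset.add_sum_erase univ _ (mem_univ (0 : F))] at h1 ⊢
    rw [χ.map_zero, zero_pow (by omega), mul_zero, zero_add,
      Finset.sum_congr rfl fun t ht => by rw [hpow t (Finset.ne_of_mem_erase ht), mul_one]]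
    rw [AddChar.map_zero_eq_one] at h1
    linear_combination h1
  have hchoose : (#T).choose 2 = k * (2 * k - 1) := by
    rw [hk, Nat.choose_two_right,
      show 2 * k * (2 * k - 1) = (k * (2 * k - 1)) * 2 by ring, Nat.mul_div_cancel _ two_pos]
  have hs : χ (-1) ^ 2 = 1 := by
    rw [← map_pow]; simp
  have hsign : χ (-1) ^ (k * (2 * k - 1)) = χ (-1) ^ k := by
    obtain ⟨l, rfl⟩ : ∃ l, k = l + 1 := ⟨k - 1, by omega⟩
    rw [show 2 * (l + 1) - 1 = 2 * l + 1 by omega,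
      show (l + 1) * (2 * l + 1) = 2 * ((l + 1) * l) + (l + 1) by ring, pow_add, pow_mul, hs,
      one_pow, one_mul]
  have hs' : χ (-1) ^ k * χ (-1) ^ k = 1 := by
    rw [← pow_add, ← two_mul, pow_mul, hs, one_pow]
  rw [sum_mul_leadSum hne, hsum, AddChar.map_zero_eq_one, prod_apply_nodalWeight hq, hchoose, hsign,
    ← hT, hk, pow_mul, hG, mul_pow] at h
  linear_combination χ (-1) ^ k * h + (-(Fintype.card F : ℂ) ^ k *
    leadSum 1 d (fun v => ∏ x ∈ T, χ (v x)) + (Fintype.card F : ℂ) ^ d *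
      (leadSum 0 m (fun v => ∏ x ∈ T, χ (v x)) - leadSum 1 m (fun v => ∏ x ∈ T, χ (v x)))) * hs'

end Reciprocity

end Duality

section QuadraticMoments

variable {F : Type*} [Field F] [Fintype F] [DecidableEq F]

theorem intCast_leadSum_prod (t : F) (d : ℕ) (T : Finset F) :
    ((leadSum t d (fun v => ∏ x ∈ T, quadraticChar F (v x)) : ℤ) : ℂ) =
      leadSum t d (fun v => ∏ x ∈ T, (quadraticChar F).ringHomComp (Int.castRingHom ℂ) (v x)) := by
  simp [leadSum]

theorem ringHomComp_quadraticChar_ne_one (hF : ringChar F ≠ 2) :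
    (quadraticChar F).ringHomComp (Int.castRingHom ℂ) ≠ 1 :=
  (MulChar.ringHomComp_ne_one_iff (Int.cast_injective (α := ℂ))).2 (quadraticChar_ne_one hF)

theorem quadraticChar_reciprocity_odd (hF : ringChar F ≠ 2) {T : Finset F} {m d k : ℕ}
    (hT : #T = m + 1 + d) (hk : #T = 2 * k + 1) :
    (Fintype.card F : ℤ) ^ (k + 1) * leadSum 1 d (fun v => ∏ x ∈ T, quadraticChar F (v x)) =
      (Fintype.card F : ℤ) ^ (d + 1) * leadSum 1 m (fun v => ∏ x ∈ T, quadraticChar F (v x)) := by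
  have h := leadSum_reciprocity_odd (ringHomComp_quadraticChar_ne_one hF)
    ((quadraticChar_isQuadratic F).comp _)
    (AddChar.FiniteField.primitiveChar_to_Complex_isPrimitive F) hT hk
  rw [← intCast_leadSum_prod, ← intCast_leadSum_prod] at h
  exact_mod_cast h

theorem quadraticChar_reciprocity_even (hF : ringChar F ≠ 2) {T : Finset F} {m d k : ℕ}
    (hT : #T = m + 1 + d) (hk : #T = 2 * k) :
    (Fintype.card F : ℤ) ^ k * leadSum 1 d (fun v => ∏ x ∈ T, quadraticChar F (v x)) =
      (Fintype.card F : ℤ) ^ d * (leadSum 0 m (fun v => ∏ x ∈ T, quadraticChar F (v x)) -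
        leadSum 1 m (fun v => ∏ x ∈ T, quadraticChar F (v x))) := by
  have h := leadSum_reciprocity_even (ringHomComp_quadraticChar_ne_one hF)
    ((quadraticChar_isQuadratic F).comp _)
    (AddChar.FiniteField.primitiveChar_to_Complex_isPrimitive F) hT hk
  rw [← intCast_leadSum_prod, ← intCast_leadSum_prod, ← intCast_leadSum_prod] at h
  exact_mod_cast h

/-- Values of polynomials at no more than `d` points are independent and uniformly distributed. -/
theorem leadSum_prod_eq_zero (hF : ringChar F ≠ 2) {T : Finset F} {d : ℕ} (h0 : T.Nonempty)
    (hd : #T ≤ d) : leadSum 1 d (fun v => ∏ x ∈ T, quadraticChar F (v x)) = 0 := by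
  obtain ⟨u, hu⟩ := h0
  set g : F[X] := Lagrange.basis T id u with hg
  have hinj : Set.InjOn (id : F → F) T := Function.injective_id.injOn
  have hgu : g.eval u = 1 := Lagrange.eval_basis_self hinj hu
  have hgx : ∀ x ∈ T.erase u, g.eval x = 0 := fun x hx =>
    Lagrange.eval_basis_of_ne (v := id) (Finset.ne_of_mem_erase hx).symm (Finset.mem_of_mem_erase hx)
  have hdeg : g.natDegree < d := by
    have h1 : g.natDegree = #T - 1 := Lagrange.natDegree_basis hinj hu
    have := Finset.card_pos.2 ⟨u, hu⟩
    omega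
  have heval : ∀ x, ∑ i : Fin d, g.coeff i * x ^ (i : ℕ) = g.eval x := fun x => by
    rw [eval_eq_sum_range' hdeg, Finset.sum_range]
  have shift : ∀ t : F, leadSum 1 d (fun v => ∏ x ∈ T, quadraticChar F (v x)) =
      leadSum 1 d (fun v => ∏ x ∈ T, quadraticChar F (v x + t * g.eval x)) := by
    intro t
    simp only [leadSum]
    refine (Fintype.sum_equiv (Equiv.addRight (fun i : Fin d => t * g.coeff i)) _ _ ?_).symm
    intro c
    refine Finset.prod_congr rfl fun x _ => ?_
    congr 1
    simp only [Equiv.coe_addRight, Pi.add_apply, add_mul, Finset.sum_add_distrib, ← heval,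
      Finset.mul_sum]
    rw [add_assoc]
    congr 2
    exact Finset.sum_congr rfl fun i _ => by ring
  have hsum : ∑ t : F, leadSum 1 d (fun v => ∏ x ∈ T, quadraticChar F (v x + t * g.eval x)) = 0 := by
    simp only [leadSum]
    rw [Finset.sum_comm]
    refine Finset.sum_eq_zero fun c _ => ?_
    simp_rw [← Finset.mul_prod_erase T _ hu, hgu, mul_one]
    have : ∀ t : F, ∏ x ∈ T.erase u, quadraticChar F
        (1 * x ^ d + ∑ i, c i * x ^ (i : ℕ) + t * g.eval x) =
        ∏ x ∈ T.erase u, quadraticChar F (1 * x ^ d + ∑ i, c i * x ^ (i : ℕ)) := fun t =>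
      Finset.prod_congr rfl fun x hx => by rw [hgx x hx, mul_zero, add_zero]
    simp_rw [this]
    have h3 : ∑ t : F, quadraticChar F (1 * u ^ d + ∑ i, c i * u ^ (i : ℕ) + t) = 0 :=
      (Equiv.sum_comp (Equiv.addLeft _) fun t => quadraticChar F t).trans
        (quadraticChar_sum_zero hF)
    rw [← Finset.sum_mul, h3, zero_mul]
  simp_rw [← shift] at hsum
  simpa using hsum

/-- The `k`-th elementary symmetric function of the values of the quadratic character along `v`. -/
def charEsymm (k : ℕ) (v : F → F) : ℤ :=
  ∑ T ∈ univ.powersetCard k, ∏ x ∈ T, quadraticChar F (v x)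

theorem leadSum_charEsymm_mul (d k : ℕ) (h : F → F) :
    leadSum 1 d (fun v => charEsymm k (fun x => h x * v x)) =
      ∑ T ∈ univ.powersetCard k, (∏ x ∈ T, quadraticChar F (h x)) *
        leadSum 1 d (fun v => ∏ x ∈ T, quadraticChar F (v x)) := by
  simp only [leadSum, charEsymm, Finset.mul_sum]
  rw [Finset.sum_comm]
  simp_rw [map_mul, Finset.prod_mul_distrib]

theorem leadSum_charEsymm_mul_congr {d k m : ℕ} (h : F → F) {a : ℤ}
    (H : ∀ T : Finset F, #T = k → leadSum 1 d (fun v => ∏ x ∈ T, quadraticChar F (v x)) =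
      a * leadSum 1 m (fun v => ∏ x ∈ T, quadraticChar F (v x))) :
    leadSum 1 d (fun v => charEsymm k (fun x => h x * v x)) =
      a * leadSum 1 m (fun v => charEsymm k (fun x => h x * v x)) := by
  rw [leadSum_charEsymm_mul, leadSum_charEsymm_mul, Finset.mul_sum]
  refine Finset.sum_congr rfl fun T hT => ?_
  rw [H T (Finset.mem_powersetCard.1 hT).2]
  ring

theorem leadSum_charEsymm_mul_eq_zero (hF : ringChar F ≠ 2) {d k : ℕ} (hk : 0 < k) (hd : k ≤ d)
    (h : F → F) : leadSum 1 d (fun v => charEsymm k (fun x => h x * v x)) = 0 := by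
  rw [leadSum_charEsymm_mul]
  refine Finset.sum_eq_zero fun T hT => ?_
  have := (Finset.mem_powersetCard.1 hT).2
  rw [leadSum_prod_eq_zero hF (Finset.card_pos.1 (by omega)) (by omega), mul_zero]

theorem leadSum_charEsymm_mul_odd (hF : ringChar F ≠ 2) {k m d j : ℕ} (hk : k = m + 1 + d)
    (hj : k = 2 * j + 1) (hmd : m ≤ d) (h : F → F) :
    leadSum 1 d (fun v => charEsymm k (fun x => h x * v x)) =
      (Fintype.card F : ℤ) ^ (d - j) * leadSum 1 m (fun v => charEsymm k (fun x => h x * v x)) := by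
  refine leadSum_charEsymm_mul_congr h fun T hT => ?_
  have h1 := quadraticChar_reciprocity_odd hF (hT.trans hk) (hT.trans hj)
  have h0 : (Fintype.card F : ℤ) ^ (j + 1) ≠ 0 := pow_ne_zero _ (by simp)
  refine mul_left_cancel₀ h0 ?_
  rw [h1, ← mul_assoc, ← pow_add]
  congr 2
  omega

theorem leadSum_three_charEsymm_four (hF : ringChar F ≠ 2) (h : F → F) :
    leadSum 1 3 (fun v => charEsymm 4 (fun x => h x * v x)) =
      -(Fintype.card F : ℤ) * charEsymm 4 h := by
  rw [leadSum_charEsymm_mul_congr (m := 0) (a := -(Fintype.card F : ℤ)) h, leadSum_zero]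
  · simp
  · intro T hT
    have h1 := quadraticChar_reciprocity_even (m := 0) (d := 3) (k := 2) hF hT hT
    have h0 : (Fintype.card F : ℤ) ^ 2 ≠ 0 := pow_ne_zero _ (by simp)
    refine mul_left_cancel₀ h0 ?_
    rw [h1]
    simp only [leadSum_zero, Finset.prod_const, hT, MulChar.map_zero]
    ring

theorem leadSum_four_charEsymm_six (hF : ringChar F ≠ 2) :
    leadSum 1 4 (charEsymm (F := F) 6) =
      ((Fintype.card F : ℤ) ^ 2 - Fintype.card F) * charEsymm 6 (fun _ : F => 1) -
        Fintype.card F * leadSum 1 1 (charEsymm (F := F) 6) := by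
  have e : ∀ d, leadSum 1 d (charEsymm (F := F) 6) = ∑ T ∈ univ.powersetCard 6,
      leadSum 1 d (fun v : F → F => ∏ x ∈ T, quadraticChar F (v x)) := fun d => by
    simpa using leadSum_charEsymm_mul d 6 (fun _ : F => 1)
  rw [e, e, charEsymm, Finset.mul_sum, Finset.mul_sum, ← Finset.sum_sub_distrib]
  refine Finset.sum_congr rfl fun T hT => ?_
  have hT := (Finset.mem_powersetCard.1 hT).2
  have h1 := quadraticChar_reciprocity_even (m := 1) (d := 4) (k := 3) hF hT hT
  have h0 : (Fintype.card F : ℤ) ^ 3 ≠ 0 := pow_ne_zero _ (by simp)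
  have h2 : leadSum 0 1 (fun v => ∏ x ∈ T, quadraticChar F (v x)) = (Fintype.card F : ℤ) - 1 := by
    rw [leadSum_zero_succ]
    simp only [leadSum_zero, Finset.prod_const, hT]
    rw [← Finset.add_sum_erase univ _ (mem_univ (0 : F)), Finset.sum_congr rfl fun t ht => by
      rw [show 6 = 2 * 3 by rfl, pow_mul, quadraticChar_sq_one (Finset.ne_of_mem_erase ht), one_pow]]
    simp [Finset.card_erase_of_mem, Nat.cast_sub Fintype.card_pos, MulChar.map_zero]
  refine mul_left_cancel₀ h0 ?_
  rw [h1, h2]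
  simp
  ring

end QuadraticMoments

section LeadSumLemmas

variable {F : Type*} [Field F] [Fintype F]

theorem leadSum_add {M : Type*} [AddCommMonoid M] (t : F) (d : ℕ) (Φ Ψ : (F → F) → M) :
    leadSum t d (fun v => Φ v + Ψ v) = leadSum t d Φ + leadSum t d Ψ :=
  Finset.sum_add_distrib

theorem leadSum_mul_left {R : Type*} [CommSemiring R] (t : F) (d : ℕ) (a : R) (Φ : (F → F) → R) :
    leadSum t d (fun v => a * Φ v) = a * leadSum t d Φ :=
  (Finset.mul_sum _ _ _).symm

theorem leadSum_const (t : F) (d : ℕ) (a : ℤ) :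
    leadSum t d (fun _ => a) = (Fintype.card F : ℤ) ^ d * a := by
  simp [leadSum]

theorem leadSum_sum {ι M : Type*} [AddCommMonoid M] (t : F) (d : ℕ) (S : Finset ι)
    (Φ : ι → (F → F) → M) :
    leadSum t d (fun v => ∑ i ∈ S, Φ i v) = ∑ i ∈ S, leadSum t d (Φ i) :=
  Finset.sum_comm

/-- Expanding polynomials around `u` instead of `0`. -/
theorem leadSum_succ_sub {M : Type*} [AddCommMonoid M] (u t : F) (d : ℕ) (Φ : (F → F) → M) :
    leadSum t (d + 1) Φ = ∑ a, leadSum t d (fun v => Φ (fun x => a + (x - u) * v x)) := by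
  induction d generalizing Φ with
  | zero =>
    rw [leadSum_succ]
    simp only [leadSum_zero]
    refine Fintype.sum_equiv (Equiv.addRight (u * t)) _ _ fun a => ?_
    congr 1
    funext x
    simp only [Equiv.coe_addRight]
    ring
  | succ d ih =>
    conv_rhs => simp only [leadSum_succ]
    rw [leadSum_succ]
    simp_rw [ih]
    rw [Finset.sum_comm]
    conv_rhs => rw [Finset.sum_comm]
    refine Finset.sum_congr rfl fun b _ => ?_
    refine Fintype.sum_equiv (Equiv.addRight (u * b)) _ _ fun a => ?_
    congr 1
    funext v
    congr 1
    funext x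
    simp only [Equiv.coe_addRight]
    ring

end LeadSumLemmas

section CharEsymm

variable {F : Type*} [Field F] [Fintype F] [DecidableEq F]

theorem sum_powersetCard_insert_prod {ι R : Type*} [DecidableEq ι] [CommSemiring R] {x : ι}
    {T : Finset ι} (hx : x ∉ T) (c : ι → R) (k : ℕ) :
    ∑ S ∈ (insert x T).powersetCard (k + 1), ∏ i ∈ S, c i =
      ∑ S ∈ T.powersetCard (k + 1), ∏ i ∈ S, c i +
        c x * ∑ S ∈ T.powersetCard k, ∏ i ∈ S, c i := by
  have hS : ∀ S ∈ T.powersetCard k, x ∉ S := fun S hS h => hx ((mem_powersetCard.1 hS).1 h)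
  rw [powersetCard_succ_insert hx, Finset.sum_union, Finset.sum_image, Finset.mul_sum]
  · congr 1
    exact Finset.sum_congr rfl fun S h => Finset.prod_insert (hS S h)
  · intro S h S' h' he
    rw [← erase_insert (hS S h), ← erase_insert (hS S' h'), he]
  · rw [Finset.disjoint_left]
    intro S h h'
    obtain ⟨S', -, rfl⟩ := Finset.mem_image.1 h'
    exact hx ((mem_powersetCard.1 h).1 (mem_insert_self _ _))

/-- Newton's identities for a sequence with values in `{-1, 0, 1}`. -/
theorem sum_powersetCard_prod_rec {ι R : Type*} [CommRing R] {c : ι → R}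
    (hc : ∀ i, c i ^ 3 = c i) (T : Finset ι) (k : ℕ) :
    ((k : R) + 2) * ∑ S ∈ T.powersetCard (k + 2), ∏ i ∈ S, c i =
      (∑ i ∈ T, c i) * ∑ S ∈ T.powersetCard (k + 1), ∏ i ∈ S, c i -
        ((∑ i ∈ T, c i ^ 2) - k) * ∑ S ∈ T.powersetCard k, ∏ i ∈ S, c i := by
  classical
  induction T using Finset.induction_on generalizing k with
  | empty =>
    have h0 : ∀ j, (∅ : Finset ι).powersetCard (j + 1) = ∅ := fun j =>
      powersetCard_eq_empty.2 (by simp)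
    cases k <;> simp [h0]
  | insert x T hx ih =>
    rw [Finset.sum_insert hx, Finset.sum_insert hx]
    have e := sum_powersetCard_insert_prod hx c
    cases k with
    | zero =>
      have i0 := ih 0
      have e1 : ∑ S ∈ T.powersetCard 1, ∏ i ∈ S, c i = ∑ i ∈ T, c i := by
        simp [powersetCard_one]
      rw [e, e]
      simp only [powersetCard_zero, sum_singleton, prod_empty, zero_add, e1] at i0 ⊢
      linear_combination i0
    | succ k =>
      have i0 := ih k
      have i1 := ih (k + 1)
      rw [e, e, e]
      push_cast at i1 ⊢
      linear_combination i1 + c x * i0 + hc x * ∑ S ∈ T.powersetCard k, ∏ i ∈ S, c i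

/-- The number of zeros of `v` in `S`. -/
def zeroCount (S : Finset F) (v : F → F) : ℤ := ∑ x ∈ S, if v x = 0 then 1 else 0

theorem charEsymm_zero (v : F → F) : charEsymm 0 v = 1 := by simp [charEsymm]

theorem charEsymm_one (v : F → F) : charEsymm 1 v = ∑ x, quadraticChar F (v x) := by
  simp [charEsymm, powersetCard_one]

theorem charEsymm_rec (v : F → F) (k : ℕ) :
    ((k : ℤ) + 2) * charEsymm (k + 2) v = charEsymm 1 v * charEsymm (k + 1) v -
      (Fintype.card F - zeroCount univ v - k) * charEsymm k v := by
  have h3 : ∀ x : F, quadraticChar F x ^ 3 = quadraticChar F x := fun x => by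
    rcases quadraticChar_isQuadratic F x with h | h | h <;> rw [h] <;> norm_num
  have h := sum_powersetCard_prod_rec (fun x => h3 (v x)) univ k
  have h2 : ∑ x, quadraticChar F (v x) ^ 2 = (Fintype.card F : ℤ) - zeroCount univ v := by
    have h1 : ∀ x, quadraticChar F (v x) ^ 2 + (if v x = 0 then 1 else 0) = 1 := fun x => by
      split_ifs with h0
      · simp [h0]
      · rw [quadraticChar_sq_one h0, add_zero]
    rw [eq_sub_iff_add_eq, zeroCount, ← Finset.sum_add_distrib]
    simp only [h1]
    simp
  rw [h2] at h
  rw [charEsymm_one]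
  exact h

/-- The polynomial in the sum `s` and the number `n` of nonzero terms of a sequence with values in
`{-1, 0, 1}` which gives `k!` times its `k`-th elementary symmetric function. -/
def signEsymm (s n : ℤ) : ℕ → ℤ
  | 0 => 1
  | 1 => s
  | k + 2 => s * signEsymm s n (k + 1) - (k + 1) * (n - k) * signEsymm s n k

theorem factorial_mul_charEsymm (v : F → F) (k : ℕ) :
    (k.factorial : ℤ) * charEsymm k v =
      signEsymm (charEsymm 1 v) (Fintype.card F - zeroCount univ v) k := by
  induction k using Nat.twoStepInduction with
  | zero => simp [charEsymm_zero, signEsymm]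
  | one => simp [signEsymm]
  | more k h0 h1 =>
    rw [signEsymm, ← h0, ← h1]
    have h := charEsymm_rec v k
    simp only [Nat.factorial_succ]
    push_cast
    linear_combination (k + 1) * (k.factorial : ℤ) * h

theorem leadSum_zeroCount_mul (t : F) (d : ℕ) (S : Finset F) (Φ : (F → F) → ℤ) :
    leadSum t (d + 1) (fun v => zeroCount S v * Φ v) =
      ∑ u ∈ S, leadSum t d (fun v => Φ (fun x => (x - u) * v x)) := by
  simp only [zeroCount, Finset.sum_mul]
  rw [leadSum_sum]
  refine Finset.sum_congr rfl fun u _ => ?_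
  rw [leadSum_succ_sub u, Finset.sum_eq_single 0]
  · simp
  · intro b _ hb
    simp [hb, leadSum]
  · simp

theorem zeroCount_sub_mul {F : Type*} [Field F] [DecidableEq F] {S : Finset F} {u : F}
    (hu : u ∈ S) (v : F → F) :
    zeroCount S (fun x => (x - u) * v x) = zeroCount (S.erase u) v + 1 := by
  rw [zeroCount, ← Finset.sum_erase_add _ _ hu, zeroCount]
  congr 1
  · refine Finset.sum_congr rfl fun x hx => ?_
    simp [sub_eq_zero, Finset.ne_of_mem_erase hx]
  · simp

theorem leadSum_zeroCount_two (t : F) (d : ℕ) (S : Finset F) (Φ : (F → F) → ℤ) :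
    leadSum t (d + 2) (fun v => zeroCount S v * ((zeroCount S v - 1) * Φ v)) =
      ∑ u ∈ S, ∑ u' ∈ S.erase u,
        leadSum t d (fun v => Φ (fun x => (x - u) * ((x - u') * v x))) := by
  rw [leadSum_zeroCount_mul]
  refine Finset.sum_congr rfl fun u hu => ?_
  simp_rw [zeroCount_sub_mul hu, add_sub_cancel_right]
  rw [leadSum_zeroCount_mul t d _ (fun v => Φ (fun x => (x - u) * v x))]

theorem leadSum_zeroCount_three (t : F) (d : ℕ) (S : Finset F) (Φ : (F → F) → ℤ) :
    leadSum t (d + 3)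
        (fun v => zeroCount S v * ((zeroCount S v - 1) * ((zeroCount S v - 2) * Φ v))) =
      ∑ u ∈ S, ∑ u' ∈ S.erase u, ∑ u'' ∈ (S.erase u).erase u',
        leadSum t d (fun v => Φ (fun x => (x - u) * ((x - u') * ((x - u'') * v x)))) := by
  rw [leadSum_zeroCount_mul]
  refine Finset.sum_congr rfl fun u hu => ?_
  simp_rw [zeroCount_sub_mul hu, add_sub_cancel_right, add_sub_assoc, show (1 : ℤ) - 2 = -1 by rfl,
    ← sub_eq_add_neg]
  rw [leadSum_zeroCount_two t d _ (fun v => Φ (fun x => (x - u) * v x))]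

end CharEsymm

section QuadraticCharSums

theorem sum_comp_affine {F M : Type*} [Field F] [Fintype F] [AddCommMonoid M] {a : F} (ha : a ≠ 0)
    (b : F) (f : F → M) : ∑ x, f (a * x + b) = ∑ x, f x :=
  ((Equiv.mulLeft₀ a ha).trans (Equiv.addRight b)).sum_comp f

variable {F : Type*} [Field F] [Fintype F] [DecidableEq F]

theorem two_mul_sum_comp_quadraticChar (hF : ringChar F ≠ 2) (f : ℤ → ℤ) :
    2 * ∑ x : F, f (quadraticChar F x) =
      2 * f 0 + ((Fintype.card F : ℤ) - 1) * (f 1 + f (-1)) := by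
  have h : ∀ x : F, 2 * f (quadraticChar F x) = (f 1 + f (-1)) +
      quadraticChar F x * (f 1 - f (-1)) + if x = 0 then 2 * f 0 - (f 1 + f (-1)) else 0 := by
    intro x
    by_cases hx : x = 0
    · simp [hx]
    · rcases quadraticChar_dichotomy hx with h | h <;> simp only [h, hx, if_false] <;> ring
  rw [Finset.mul_sum, Finset.sum_congr rfl fun x _ => h x, Finset.sum_add_distrib,
    Finset.sum_add_distrib, ← Finset.sum_mul, quadraticChar_sum_zero hF]
  simp
  ring

theorem sum_sq_eq (hF : ringChar F ≠ 2) (a : F) :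
    ∑ x : F, (if x ^ 2 = a then (1 : ℤ) else 0) = quadraticChar F a + 1 := by
  rw [← quadraticChar_card_sqrts hF, Set.toFinset_ofPred, Finset.sum_boole]

theorem sum_comp_sq (hF : ringChar F ≠ 2) (f : F → ℤ) :
    ∑ x, f (x ^ 2) = ∑ z, (quadraticChar F z + 1) * f z := by
  have h : ∀ x : F, f (x ^ 2) = ∑ z, (if x ^ 2 = z then (1 : ℤ) else 0) * f z := fun x => by simp
  rw [Finset.sum_congr rfl fun x _ => h x, Finset.sum_comm]
  simp_rw [← Finset.sum_mul, sum_sq_eq hF]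

theorem sum_quadraticChar_sq_sub (hF : ringChar F ≠ 2) (D : F) :
    ∑ x, quadraticChar F (x ^ 2 - D) = if D = 0 then (Fintype.card F : ℤ) - 1 else -1 := by
  have h2 : (2 : F) ≠ 0 := Ring.two_ne_zero hF
  have h : ∑ x, (quadraticChar F (x ^ 2 - D) + 1) =
      ∑ z : F, ∑ x : F, if z * (2 * x + z) = -D then (1 : ℤ) else 0 := by
    simp_rw [← sum_sq_eq hF]
    conv_rhs => rw [Finset.sum_comm]
    refine Finset.sum_congr rfl fun x _ => ?_
    refine (Fintype.sum_equiv (Equiv.addLeft x) _ _ fun z => ?_).symm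
    congr 1
    simp only [Equiv.coe_addLeft, eq_iff_iff]
    constructor <;> intro h <;> linear_combination h
  have hz : ∀ z : F, z ≠ 0 → ∑ x : F, (if z * (2 * x + z) = -D then (1 : ℤ) else 0) = 1 := by
    intro z hz
    have := sum_comp_affine (mul_ne_zero hz h2) (z ^ 2) (fun y => if y = -D then (1 : ℤ) else 0)
    rw [Finset.sum_ite_eq' univ (-D) (fun _ => (1 : ℤ)), if_pos (mem_univ _)] at this
    refine (Finset.sum_congr rfl fun x _ => ?_).trans this
    rw [show z * (2 * x + z) = z * 2 * x + z ^ 2 by ring]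
  rw [← Finset.add_sum_erase univ (fun z : F => ∑ x : F, _) (mem_univ (0 : F)),
    Finset.sum_congr rfl fun z h => hz z (Finset.ne_of_mem_erase h), Finset.sum_add_distrib] at h
  simp only [zero_mul, zero_eq_neg, sum_const, card_univ, card_erase_of_mem (mem_univ _),
    nsmul_eq_mul, mul_one, Nat.cast_sub (Fintype.card_pos (α := F)), Nat.cast_succ] at h
  split_ifs at h ⊢ <;> simp [-quadraticChar_apply] at h <;> linarith

theorem charEsymm_one_sq_sub (hF : ringChar F ≠ 2) (c D : F) :
    charEsymm 1 (fun x => (x + c) ^ 2 - D) = if D = 0 then (Fintype.card F : ℤ) - 1 else -1 := by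
  rw [charEsymm_one, ← sum_quadraticChar_sq_sub hF]
  exact Equiv.sum_comp (Equiv.addRight c) (fun x => quadraticChar F (x ^ 2 - D))

theorem zeroCount_sq_sub (hF : ringChar F ≠ 2) (c D : F) :
    zeroCount univ (fun x => (x + c) ^ 2 - D) = quadraticChar F D + 1 := by
  rw [zeroCount, ← sum_sq_eq hF]
  simp_rw [sub_eq_zero]
  exact Equiv.sum_comp (Equiv.addRight c) (fun x => if x ^ 2 = D then (1 : ℤ) else 0)

theorem charEsymm_one_of_bijective (hF : ringChar F ≠ 2) {v : F → F} (hv : v.Bijective) :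
    charEsymm 1 v = 0 := by
  rw [charEsymm_one, hv.sum_comp (fun x => quadraticChar F x), quadraticChar_sum_zero hF]

theorem zeroCount_of_bijective {v : F → F} (hv : v.Bijective) : zeroCount univ v = 1 := by
  rw [zeroCount, hv.sum_comp (fun x => if x = 0 then (1 : ℤ) else 0)]
  simp

theorem factorial_mul_charEsymm_one (k : ℕ) :
    (k.factorial : ℤ) * charEsymm k (fun _ : F => 1) =
      signEsymm (Fintype.card F) (Fintype.card F) k := by
  rw [factorial_mul_charEsymm, charEsymm_one]
  simp [zeroCount]

theorem factorial_mul_charEsymm_of_bijective (hF : ringChar F ≠ 2) {v : F → F} (hv : v.Bijective)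
    (k : ℕ) : (k.factorial : ℤ) * charEsymm k v = signEsymm 0 (Fintype.card F - 1) k := by
  rw [factorial_mul_charEsymm, charEsymm_one_of_bijective hF hv, zeroCount_of_bijective hv]

theorem factorial_mul_charEsymm_sub_mul_sub (hF : ringChar F ≠ 2) (u t : F) (k : ℕ) :
    (k.factorial : ℤ) * charEsymm k (fun x => (x - u) * (x - t)) =
      if u = t then signEsymm (Fintype.card F - 1) (Fintype.card F - 1) k
      else signEsymm (-1) (Fintype.card F - 2) k := by
  have h2 : (2 : F) ≠ 0 := Ring.two_ne_zero hF
  have h : (fun x => (x - u) * (x - t)) =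
      fun x => (x + -((u + t) / 2)) ^ 2 - ((u - t) / 2) ^ 2 := by
    funext x
    field_simp
    ring
  rw [factorial_mul_charEsymm, h, charEsymm_one_sq_sub hF, zeroCount_sq_sub hF]
  by_cases hut : u = t
  · simp [hut]
  · have h0 : (u - t) / 2 ≠ 0 := div_ne_zero (sub_ne_zero.2 hut) h2
    rw [if_neg (pow_ne_zero _ h0), if_neg hut, quadraticChar_sq_one' h0, one_add_one_eq_two]

theorem two_mul_factorial_mul_leadSum_two (hF : ringChar F ≠ 2) (k : ℕ) :
    2 * (k.factorial : ℤ) * leadSum 1 2 (charEsymm (F := F) k) = Fintype.card F *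
      (2 * signEsymm (Fintype.card F - 1) (Fintype.card F - 1) k + (Fintype.card F - 1) *
        (signEsymm (-1) (Fintype.card F - 2) k + signEsymm (-1) (Fintype.card F) k)) := by
  have h2 : (2 : F) ≠ 0 := Ring.two_ne_zero hF
  have e : leadSum 1 2 (charEsymm (F := F) k) =
      ∑ c : F, ∑ D : F, charEsymm k (fun x => (x + c) ^ 2 - D) := by
    rw [leadSum_succ]
    simp_rw [leadSum_succ, leadSum_zero]
    rw [Finset.sum_comm, ← sum_comp_affine h2 0]
    refine Finset.sum_congr rfl fun c _ => ?_
    rw [← sum_comp_affine (neg_ne_zero.2 (one_ne_zero (α := F))) (c ^ 2)]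
    refine Finset.sum_congr rfl fun D _ => ?_
    congr 1
    funext x
    ring
  have e2 : ∀ c D : F, (k.factorial : ℤ) * charEsymm k (fun x => (x + c) ^ 2 - D) =
      (fun j : ℤ => signEsymm (if j = 0 then (Fintype.card F : ℤ) - 1 else -1)
        (Fintype.card F - (j + 1)) k) (quadraticChar F D) := fun c D => by
    rw [factorial_mul_charEsymm, charEsymm_one_sq_sub hF, zeroCount_sq_sub hF]
    simp only [quadraticChar_eq_zero_iff]
  have e3 : ∀ c : F, 2 * ∑ D : F, (k.factorial : ℤ) * charEsymm k (fun x => (x + c) ^ 2 - D) =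
      2 * signEsymm (Fintype.card F - 1) (Fintype.card F - 1) k + (Fintype.card F - 1) *
        (signEsymm (-1) (Fintype.card F - 2) k + signEsymm (-1) (Fintype.card F) k) := fun c => by
    have h := two_mul_sum_comp_quadraticChar hF fun j : ℤ => signEsymm
      (if j = 0 then (Fintype.card F : ℤ) - 1 else -1) (Fintype.card F - (j + 1)) k
    rw [Finset.sum_congr rfl fun D _ => e2 c D]
    refine h.trans ?_
    norm_num
  rw [e, mul_assoc, Finset.mul_sum, Finset.mul_sum]
  simp_rw [Finset.mul_sum _ _ (k.factorial : ℤ), e3]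
  simp

end QuadraticCharSums

section SeventhMoment

variable {F : Type*} [Field F] [Fintype F] [DecidableEq F]

theorem leadSum_charEsymm_eq_zero (hF : ringChar F ≠ 2) {d k : ℕ} (hk : 0 < k) (hd : k ≤ d) :
    leadSum 1 d (charEsymm (F := F) k) = 0 := by
  simpa using leadSum_charEsymm_mul_eq_zero hF hk hd (fun _ : F => 1)

theorem leadSum_charEsymm_odd (hF : ringChar F ≠ 2) {k m d j : ℕ} (hk : k = m + 1 + d)
    (hj : k = 2 * j + 1) (hmd : m ≤ d) :
    leadSum 1 d (charEsymm (F := F) k) =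
      (Fintype.card F : ℤ) ^ (d - j) * leadSum 1 m (charEsymm (F := F) k) := by
  simpa using leadSum_charEsymm_mul_odd hF hk hj hmd (fun _ : F => 1)

theorem factorial_mul_leadSum_one (hF : ringChar F ≠ 2) (k : ℕ) :
    (k.factorial : ℤ) * leadSum 1 1 (charEsymm (F := F) k) =
      Fintype.card F * signEsymm 0 (Fintype.card F - 1) k := by
  have h : ∀ a : F, (k.factorial : ℤ) * charEsymm k (fun x => a + x) =
      signEsymm 0 (Fintype.card F - 1) k := fun a =>
    factorial_mul_charEsymm_of_bijective hF (Equiv.addLeft a).bijective k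
  rw [leadSum_succ, Finset.mul_sum]
  simp only [leadSum_zero, mul_one, h]
  simp

theorem leadSum_zeroCount_mul_charEsymm_eq_zero (hF : ringChar F ≠ 2) {d k : ℕ} (hk : 0 < k)
    (hd : k ≤ d) :
    leadSum 1 (d + 1) (fun v : F → F => zeroCount univ v * charEsymm k v) = 0 := by
  rw [leadSum_zeroCount_mul]
  exact Finset.sum_eq_zero fun u _ => leadSum_charEsymm_mul_eq_zero hF hk hd _

theorem leadSum_zeroCount_two_charEsymm_eq_zero (hF : ringChar F ≠ 2) {d k : ℕ} (hk : 0 < k)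
    (hd : k ≤ d) :
    leadSum 1 (d + 2) (fun v : F → F => zeroCount univ v * ((zeroCount univ v - 1) *
      charEsymm k v)) = 0 := by
  rw [leadSum_zeroCount_two]
  refine Finset.sum_eq_zero fun u _ => Finset.sum_eq_zero fun t _ => ?_
  simp_rw [← mul_assoc]
  exact leadSum_charEsymm_mul_eq_zero hF hk hd _

theorem leadSum_zeroCount_three_charEsymm_eq_zero (hF : ringChar F ≠ 2) {d k : ℕ} (hk : 0 < k)
    (hd : k ≤ d) :
    leadSum 1 (d + 3) (fun v : F → F => zeroCount univ v * ((zeroCount univ v - 1) *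
      ((zeroCount univ v - 2) * charEsymm k v))) = 0 := by
  rw [leadSum_zeroCount_three]
  refine Finset.sum_eq_zero fun u _ => Finset.sum_eq_zero fun t _ =>
    Finset.sum_eq_zero fun s _ => ?_
  simp_rw [← mul_assoc]
  exact leadSum_charEsymm_mul_eq_zero hF hk hd _

theorem leadSum_four_zeroCount_charEsymm_five (hF : ringChar F ≠ 2) :
    120 * leadSum 1 4 (fun v : F → F => zeroCount univ v * charEsymm 5 v) =
      (Fintype.card F : ℤ) ^ 2 * (signEsymm (Fintype.card F - 1) (Fintype.card F - 1) 5 +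
        (Fintype.card F - 1) * signEsymm (-1) (Fintype.card F - 2) 5) := by
  have h : ∀ u : F, 120 * leadSum 1 1 (fun v : F → F => charEsymm 5 (fun x => (x - u) * v x)) =
      signEsymm (Fintype.card F - 1) (Fintype.card F - 1) 5 +
        (Fintype.card F - 1) * signEsymm (-1) (Fintype.card F - 2) 5 := fun u => by
    rw [leadSum_succ]
    simp only [leadSum_zero, mul_one]
    rw [← Equiv.sum_comp (Equiv.neg F), Finset.mul_sum, ← Finset.add_sum_erase univ _ (mem_univ u)]
    have e : ∀ t : F, 120 * charEsymm 5 (fun x => (x - u) * ((Equiv.neg F) t + x)) =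
        if u = t then signEsymm (Fintype.card F - 1) (Fintype.card F - 1) 5
        else signEsymm (-1) (Fintype.card F - 2) 5 := fun t => by
      rw [← factorial_mul_charEsymm_sub_mul_sub hF]
      simp [sub_eq_neg_add, Nat.factorial]
    rw [e, if_pos rfl, Finset.sum_congr rfl fun t ht => (e t).trans
      (if_neg (Finset.ne_of_mem_erase ht).symm)]
    simp [card_erase_of_mem, Nat.cast_sub (Fintype.card_pos (α := F))]
  rw [leadSum_zeroCount_mul, Finset.mul_sum]
  simp_rw [fun u : F => leadSum_charEsymm_mul_odd (k := 5) (m := 1) (d := 3) (j := 2) hF rfl rfl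
    (by norm_num) (fun x => x - u), mul_left_comm (120 : ℤ), h]
  simp
  ring

theorem leadSum_four_zeroCount_charEsymm_four (hF : ringChar F ≠ 2) :
    24 * leadSum 1 4 (fun v : F → F => zeroCount univ v * charEsymm 4 v) =
      -(Fintype.card F : ℤ) ^ 2 * signEsymm 0 (Fintype.card F - 1) 4 := by
  have h : ∀ u : F, 24 * charEsymm 4 (fun x => x - u) = signEsymm 0 (Fintype.card F - 1) 4 :=
    fun u => factorial_mul_charEsymm_of_bijective hF (Equiv.subRight u).bijective 4
  rw [leadSum_zeroCount_mul, Finset.mul_sum]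
  simp_rw [leadSum_three_charEsymm_four hF, mul_left_comm (24 : ℤ), h]
  simp
  ring

theorem leadSum_four_zeroCount_two_charEsymm_three (hF : ringChar F ≠ 2) :
    6 * leadSum 1 4 (fun v : F → F => zeroCount univ v * ((zeroCount univ v - 1) *
      charEsymm 3 v)) = (Fintype.card F : ℤ) ^ 2 * (Fintype.card F - 1) *
        signEsymm (-1) (Fintype.card F - 2) 3 := by
  have h : ∀ u, ∀ t ∈ univ.erase u, 6 * charEsymm 3 (fun x : F => (x - u) * (x - t)) =
      signEsymm (-1) (Fintype.card F - 2) 3 := fun u t ht =>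
    (factorial_mul_charEsymm_sub_mul_sub hF u t 3).trans (if_neg (Finset.ne_of_mem_erase ht).symm)
  have h' : ∀ u, ∀ t ∈ univ.erase u,
      6 * leadSum 1 2 (fun v : F → F => charEsymm 3 (fun x => (x - u) * ((x - t) * v x))) =
        (Fintype.card F : ℤ) * signEsymm (-1) (Fintype.card F - 2) 3 := fun u t ht => by
    rw [← h u t ht]
    simp_rw [← mul_assoc]
    rw [leadSum_charEsymm_mul_odd (m := 0) (d := 2) (j := 1) hF rfl rfl (by norm_num), leadSum_zero]
    simp
    ring
  rw [leadSum_zeroCount_two, Finset.mul_sum, Finset.sum_congr rfl fun u _ =>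
    (Finset.mul_sum _ _ _).trans (Finset.sum_congr rfl (h' u))]
  simp [card_erase_of_mem, Nat.cast_sub (Fintype.card_pos (α := F))]
  ring

theorem leadSum_zeroCount (d : ℕ) :
    leadSum 1 (d + 1) (fun v : F → F => zeroCount univ v) = (Fintype.card F : ℤ) ^ (d + 1) := by
  have h := leadSum_zeroCount_mul (1 : F) d univ (fun _ => 1)
  simp only [mul_one] at h
  rw [h]
  simp [leadSum_const]
  ring

theorem leadSum_zeroCount_mul_pred (d : ℕ) :
    leadSum 1 (d + 2) (fun v : F → F => zeroCount univ v * (zeroCount univ v - 1)) =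
      (Fintype.card F : ℤ) ^ (d + 1) * (Fintype.card F - 1) := by
  have h := leadSum_zeroCount_two (1 : F) d univ (fun _ => 1)
  simp only [mul_one] at h
  rw [h]
  simp [leadSum_const, card_erase_of_mem, Nat.cast_sub (Fintype.card_pos (α := F))]
  ring

theorem leadSum_zeroCount_mul_pred_mul_pred (d : ℕ) :
    leadSum 1 (d + 3) (fun v : F → F => zeroCount univ v * ((zeroCount univ v - 1) *
      (zeroCount univ v - 2))) =
      (Fintype.card F : ℤ) ^ (d + 1) * (Fintype.card F - 1) * (Fintype.card F - 2) := by
  have h := leadSum_zeroCount_three (1 : F) d univ (fun _ => 1)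
  simp only [mul_one] at h
  have hc : ∀ u : F, ∀ t ∈ univ.erase u, (#((univ.erase u).erase t) : ℤ) = Fintype.card F - 2 := by
    intro u t ht
    have h1 := card_erase_add_one ht
    have h2 := card_erase_add_one (mem_univ u)
    rw [card_univ] at h2
    omega
  rw [h]
  simp_rw [leadSum_const, sum_const, nsmul_eq_mul]
  rw [Finset.sum_congr rfl fun u _ => Finset.sum_congr rfl fun t ht => by rw [hc u t ht]]
  simp [card_erase_of_mem, Nat.cast_sub (Fintype.card_pos (α := F))]
  ring

theorem one_add_charEsymm_one_pow_seven (v : F → F) {q r : ℤ} (hq : q = Fintype.card F)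
    (hr : r = zeroCount univ v) :
    (1 + charEsymm 1 v) ^ 7 = 5040 * (charEsymm 7 v + charEsymm 6 v) +
      (2520 * (q + 1 - r) - 8400) * (charEsymm 5 v + charEsymm 4 v) +
      (630 * (q + 1 - r) ^ 2 - 2940 * (q + 1 - r) + 3696) * (charEsymm 3 v + charEsymm 2 v) +
      (105 * (q + 1 - r) ^ 3 - 420 * (q + 1 - r) ^ 2 + 588 * (q + 1 - r) - 272) *
        (charEsymm 1 v + 1) := by
  have h := factorial_mul_charEsymm v
  rw [← hq, ← hr] at h
  have h2 := h 2
  have h3 := h 3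
  have h4 := h 4
  have h5 := h 5
  have h6 := h 6
  have h7 := h 7
  simp only [Nat.factorial, signEsymm] at h2 h3 h4 h5 h6 h7
  push_cast at h2 h3 h4 h5 h6 h7
  linear_combination (-1) * h7 - 7 * h6 - (21 * (q + 1 - r) - 70) * h5 -
    (105 * (q + 1 - r) - 350) * h4 - (105 * (q + 1 - r) ^ 2 - 490 * (q + 1 - r) + 616) * h3 -
    (315 * (q + 1 - r) ^ 2 - 1470 * (q + 1 - r) + 1848) * h2

/-- The seventh moment of `1 + ∑ x, η (Q x)` over the monic quartic polynomials `Q`, where `η` is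
the quadratic character. -/
theorem leadSum_four_one_add_pow_seven (hF : ringChar F ≠ 2) {q : ℤ} (hq : q = Fintype.card F) :
    leadSum 1 4 (fun v : F → F => (1 + charEsymm 1 v) ^ 7) =
      q * (q * (q - 1) * (14 * q ^ 4 - 28 * q ^ 2 - 20 * q - 7) + q ^ 7 +
        (q - 1) * (q ^ 7 + 21 * q ^ 5 + 35 * q ^ 3 + 7 * q)) := by
  set A₁ := 105 * (q + 1) ^ 3 - 420 * (q + 1) ^ 2 + 588 * (q + 1) - 272
  set A₃ := 630 * (q + 1) ^ 2 - 2940 * (q + 1) + 3696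
  set A₅ := 2520 * (q + 1) - 8400
  set B₁ := -315 * (q + 1) ^ 2 + 1155 * (q + 1) - 1113
  set B₃ := -1260 * (q + 1) + 3570
  set C₁ := 315 * (q + 1) - 735
  have key : ∀ v : F → F, (1 + charEsymm 1 v) ^ 7 = 5040 * charEsymm 7 v + 5040 * charEsymm 6 v +
      A₅ * charEsymm 5 v + A₅ * charEsymm 4 v + A₃ * charEsymm 3 v + A₃ * charEsymm 2 v +
      A₁ * charEsymm 1 v + (-2520) * (zeroCount univ v * charEsymm 5 v) +
      (-2520) * (zeroCount univ v * charEsymm 4 v) + B₃ * (zeroCount univ v * charEsymm 3 v) +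
      B₃ * (zeroCount univ v * charEsymm 2 v) + B₁ * (zeroCount univ v * charEsymm 1 v) +
      630 * (zeroCount univ v * ((zeroCount univ v - 1) * charEsymm 3 v)) +
      630 * (zeroCount univ v * ((zeroCount univ v - 1) * charEsymm 2 v)) +
      C₁ * (zeroCount univ v * ((zeroCount univ v - 1) * charEsymm 1 v)) +
      (-105) * (zeroCount univ v * ((zeroCount univ v - 1) * ((zeroCount univ v - 2) *
        charEsymm 1 v))) +
      A₁ + B₁ * zeroCount univ v + C₁ * (zeroCount univ v * (zeroCount univ v - 1)) +
      (-105) * (zeroCount univ v * ((zeroCount univ v - 1) * (zeroCount univ v - 2))) := fun v => by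
    rw [one_add_charEsymm_one_pow_seven v hq rfl]
    ring
  simp_rw [key, leadSum_add, leadSum_mul_left]
  have h7 := two_mul_factorial_mul_leadSum_two hF 7
  have h61 := factorial_mul_charEsymm_one (F := F) 6
  have h6 := factorial_mul_leadSum_one hF 6
  have h5 := factorial_mul_charEsymm_one (F := F) 5
  have h5r := leadSum_four_zeroCount_charEsymm_five hF
  have h4r := leadSum_four_zeroCount_charEsymm_four hF
  have h3r := leadSum_four_zeroCount_two_charEsymm_three hF
  rw [leadSum_charEsymm_odd (k := 7) (m := 2) (d := 4) (j := 3) hF rfl rfl (by norm_num),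
    leadSum_four_charEsymm_six hF,
    leadSum_charEsymm_odd (k := 5) (m := 0) (d := 4) (j := 2) hF rfl rfl (by norm_num),
    leadSum_zero, leadSum_charEsymm_eq_zero (k := 4) hF (by norm_num) (by norm_num),
    leadSum_charEsymm_eq_zero (k := 3) hF (by norm_num) (by norm_num),
    leadSum_charEsymm_eq_zero (k := 2) hF (by norm_num) (by norm_num),
    leadSum_charEsymm_eq_zero (k := 1) hF (by norm_num) (by norm_num),
    leadSum_zeroCount_mul_charEsymm_eq_zero (k := 3) hF (by norm_num) (by norm_num),
    leadSum_zeroCount_mul_charEsymm_eq_zero (k := 2) hF (by norm_num) (by norm_num),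
    leadSum_zeroCount_mul_charEsymm_eq_zero (k := 1) hF (by norm_num) (by norm_num),
    leadSum_zeroCount_two_charEsymm_eq_zero (k := 2) hF (by norm_num) (by norm_num),
    leadSum_zeroCount_two_charEsymm_eq_zero (k := 1) hF (by norm_num) (by norm_num),
    leadSum_zeroCount_three_charEsymm_eq_zero (k := 1) hF (by norm_num) (by norm_num),
    leadSum_const, leadSum_zeroCount, leadSum_zeroCount_mul_pred,
    leadSum_zeroCount_mul_pred_mul_pred]
  rw [← hq] at *
  simp only [Nat.factorial, signEsymm] at h7 h61 h6 h5 h5r h4r h3r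
  push_cast at h7 h61 h6 h5 h5r h4r h3r
  refine mul_left_cancel₀ (two_ne_zero (α := ℤ)) ?_
  linear_combination q * h7 + 14 * (q ^ 2 - q) * h61 - 14 * q * h6 +
    2 * (21 * (q + 1) - 70) * q ^ 2 * h5 - 42 * h5r - 210 * h4r + 210 * h3r

end SeventhMoment

section CubicSums

theorem sum_sum_sum_reverse {ι₁ ι₂ ι₃ M : Type*} [Fintype ι₁] [Fintype ι₂] [Fintype ι₃]
    [AddCommMonoid M] (f : ι₁ → ι₂ → ι₃ → M) :
    ∑ a, ∑ b, ∑ c, f a b c = ∑ c, ∑ b, ∑ a, f a b c := by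
  rw [Finset.sum_comm, Finset.sum_congr rfl fun b _ => Finset.sum_comm, Finset.sum_comm]

theorem sum_sum_sum_sum_reverse {ι₁ ι₂ ι₃ ι₄ M : Type*} [Fintype ι₁] [Fintype ι₂] [Fintype ι₃]
    [Fintype ι₄] [AddCommMonoid M] (f : ι₁ → ι₂ → ι₃ → ι₄ → M) :
    ∑ a, ∑ b, ∑ c, ∑ d, f a b c d = ∑ d, ∑ c, ∑ b, ∑ a, f a b c d := by
  rw [Finset.sum_comm, Finset.sum_congr rfl fun b _ => sum_sum_sum_reverse (fun a => f a b),
    Finset.sum_comm, Finset.sum_congr rfl fun d _ => Finset.sum_comm]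

variable {F : Type*} [Field F] [Fintype F]

/-- Monic quartic polynomials are parametrized by their depressed form and a translation. -/
theorem leadSum_four (h2 : (2 : F) ≠ 0) (h3 : (3 : F) ≠ 0) {M : Type*} [AddCommMonoid M]
    (Φ : (F → F) → M) :
    leadSum 1 4 Φ = ∑ c : F, ∑ x : F, ∑ y : F, ∑ A : F,
      Φ (fun s => (s + c) ^ 4 - 6 * x * (s + c) ^ 2 + 8 * y * (s + c) - 3 * x ^ 2 - 4 * A) := by
  have h4 : (4 : F) ≠ 0 := by rw [show (4 : F) = 2 * 2 by norm_num]; exact mul_ne_zero h2 h2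
  have h6 : (-6 : F) ≠ 0 := by
    rw [neg_ne_zero, show (6 : F) = 2 * 3 by norm_num]; exact mul_ne_zero h2 h3
  have h8 : (8 : F) ≠ 0 := by rw [show (8 : F) = 2 * 4 by norm_num]; exact mul_ne_zero h2 h4
  simp only [leadSum_succ, leadSum_zero]
  rw [sum_sum_sum_sum_reverse, ← sum_comp_affine h4 0]
  refine Finset.sum_congr rfl fun c _ => ?_
  rw [← sum_comp_affine h6 (6 * c ^ 2)]
  refine Finset.sum_congr rfl fun x _ => ?_
  rw [← sum_comp_affine h8 (4 * c ^ 3 - 12 * x * c)]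
  refine Finset.sum_congr rfl fun y _ => ?_
  rw [← sum_comp_affine (neg_ne_zero.2 h4) (c ^ 4 - 6 * x * c ^ 2 + 8 * y * c - 3 * x ^ 2)]
  refine Finset.sum_congr rfl fun A _ => ?_
  congr 1
  funext s
  ring

variable [DecidableEq F]

/-- The sum of the quadratic character along `x ^ 3 + A * x + B`, which is the negative of the
trace of Frobenius of the corresponding Weierstrass curve. -/
def cubicSum (A B : F) : ℤ := ∑ x, quadraticChar F (x ^ 3 + A * x + B)

theorem sum_quadratic_eq_zero (hF : ringChar F ≠ 2) (b c : F) :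
    ∑ x : F, (if x ^ 2 + b * x + c = 0 then (1 : ℤ) else 0) =
      quadraticChar F (b ^ 2 - 4 * c) + 1 := by
  have h2 : (2 : F) ≠ 0 := Ring.two_ne_zero hF
  have h4 : (4 : F) ≠ 0 := by rw [show (4 : F) = 2 * 2 by norm_num]; exact mul_ne_zero h2 h2
  rw [← sum_sq_eq hF]
  conv_rhs => rw [← sum_comp_affine h2 b]
  refine Finset.sum_congr rfl fun x _ => ?_
  congr 1
  rw [eq_iff_iff, ← sub_eq_zero (a := (2 * x + b) ^ 2),
    show (2 * x + b) ^ 2 - (b ^ 2 - 4 * c) = 4 * (x ^ 2 + b * x + c) by ring, mul_eq_zero,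
    or_iff_right h4]

/-- Counting the lines through a point `(x, y)` of a Weierstrass curve by their further
intersections with the curve. -/
theorem one_add_sum_quadraticChar_quartic (hF : ringChar F ≠ 2) (A x y : F) :
    1 + ∑ s, quadraticChar F (s ^ 4 - 6 * x * s ^ 2 + 8 * y * s - 3 * x ^ 2 - 4 * A) =
      cubicSum A (y ^ 2 - x ^ 3 - A * x) +
        if y = 0 ∧ 3 * x ^ 2 + A = 0 then (Fintype.card F : ℤ) else 0 := by
  have h2 : (2 : F) ≠ 0 := Ring.two_ne_zero hF
  set f : F → F := fun z => z ^ 3 + A * z + (y ^ 2 - x ^ 3 - A * x) with hf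
  have hs : ∑ s, (quadraticChar F (s ^ 4 - 6 * x * s ^ 2 + 8 * y * s - 3 * x ^ 2 - 4 * A) + 1) =
      ∑ z : F, ∑ s : F, if z ^ 2 + (x - s ^ 2) * z + (x ^ 2 + A + s ^ 2 * x - 2 * s * y) = 0
        then (1 : ℤ) else 0 := by
    rw [Finset.sum_comm]
    refine Finset.sum_congr rfl fun s _ => ?_
    rw [sum_quadratic_eq_zero hF]
    congr 2
    ring
  have hz : ∀ z ∈ univ.erase x, ∑ s : F, (if z ^ 2 + (x - s ^ 2) * z +
      (x ^ 2 + A + s ^ 2 * x - 2 * s * y) = 0 then (1 : ℤ) else 0) = quadraticChar F (f z) + 1 := by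
    intro z hz
    have h0 : z - x ≠ 0 := sub_ne_zero.2 (Finset.ne_of_mem_erase hz)
    rw [← sum_sq_eq hF]
    conv_rhs => rw [← sum_comp_affine h0 y]
    refine Finset.sum_congr rfl fun s _ => ?_
    congr 1
    rw [eq_iff_iff, ← sub_eq_zero (b := f z), ← neg_eq_zero (a := _ - _),
      show -(((z - x) * s + y) ^ 2 - f z) = (z - x) *
        (z ^ 2 + (x - s ^ 2) * z + (x ^ 2 + A + s ^ 2 * x - 2 * s * y)) by simp only [hf]; ring,
      mul_eq_zero, or_iff_right h0]
  have hx : ∑ s : F, (if x ^ 2 + (x - s ^ 2) * x + (x ^ 2 + A + s ^ 2 * x - 2 * s * y) = 0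
      then (1 : ℤ) else 0) = quadraticChar F (f x) +
        if y = 0 ∧ 3 * x ^ 2 + A = 0 then (Fintype.card F : ℤ) else 0 := by
    have e : ∀ s, x ^ 2 + (x - s ^ 2) * x + (x ^ 2 + A + s ^ 2 * x - 2 * s * y) =
        -2 * y * s + (3 * x ^ 2 + A) := fun s => by ring
    simp_rw [e, show f x = y ^ 2 by simp only [hf]; ring]
    by_cases hy : y = 0
    · by_cases h0 : 3 * x ^ 2 + A = 0 <;> simp [hy, h0]
    · rw [sum_comp_affine (mul_ne_zero (neg_ne_zero.2 h2) hy) _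
        (fun z => if z = 0 then (1 : ℤ) else 0), quadraticChar_sq_one' hy]
      simp [hy]
  rw [← Finset.add_sum_erase univ (fun z : F => ∑ s : F, _) (mem_univ x), hx,
    Finset.sum_congr rfl hz, Finset.sum_add_distrib, Finset.sum_add_distrib] at hs
  have hc : cubicSum A (y ^ 2 - x ^ 3 - A * x) = quadraticChar F (f x) +
      ∑ z ∈ univ.erase x, quadraticChar F (f z) := (Finset.add_sum_erase univ _ (mem_univ x)).symm
  simp only [sum_const, card_univ, card_erase_of_mem (mem_univ _), nsmul_eq_mul, mul_one,
    Nat.cast_sub (Fintype.card_pos (α := F)), Nat.cast_one] at hs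
  rw [hc]
  linarith

theorem cubicSum_twist {d : F} (hd : d ≠ 0) (A B : F) :
    cubicSum (d ^ 2 * A) (d ^ 3 * B) = quadraticChar F d * cubicSum A B := by
  rw [cubicSum, cubicSum, Finset.mul_sum, ← sum_comp_affine hd 0]
  refine Finset.sum_congr rfl fun x _ => ?_
  rw [show (d * x + 0) ^ 3 + d ^ 2 * A * (d * x + 0) + d ^ 3 * B = d ^ 2 * d * (x ^ 3 + A * x + B)
    by ring, map_mul, map_mul, quadraticChar_sq_one' hd, one_mul]

theorem sum_cubicSum_pow_odd (hF : ringChar F ≠ 2) {n : ℕ} (hn : Odd n) :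
    ∑ A : F, ∑ B : F, cubicSum A B ^ n = 0 := by
  obtain ⟨d, hd⟩ := quadraticChar_exists_neg_one hF
  have h0 : d ≠ 0 := by
    rintro rfl
    simp at hd
  have h : ∑ A : F, ∑ B : F, cubicSum A B ^ n = -∑ A : F, ∑ B : F, cubicSum A B ^ n := by
    conv_lhs => rw [← sum_comp_affine (pow_ne_zero 2 h0) 0]
    rw [← Finset.sum_neg_distrib]
    refine Finset.sum_congr rfl fun A _ => ?_
    rw [← sum_comp_affine (pow_ne_zero 3 h0) 0, ← Finset.sum_neg_distrib]
    refine Finset.sum_congr rfl fun B _ => ?_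
    rw [add_zero, add_zero, cubicSum_twist h0, hd, neg_one_mul, hn.neg_pow]
  linarith

theorem cubicSum_singular (hF : ringChar F ≠ 2) (t : F) :
    cubicSum (-(3 * t ^ 2)) (2 * t ^ 3) = -quadraticChar F (3 * t) := by
  have h : ∑ x, quadraticChar F (x + 2 * t) = 0 :=
    (Equiv.sum_comp (Equiv.addRight (2 * t)) fun x => quadraticChar F x).trans
      (quadraticChar_sum_zero hF)
  rw [← Finset.add_sum_erase univ _ (mem_univ t)] at h
  rw [cubicSum, ← Finset.add_sum_erase univ _ (mem_univ t),
    show t ^ 3 + -(3 * t ^ 2) * t + 2 * t ^ 3 = 0 by ring, MulChar.map_zero, zero_add,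
    Finset.sum_congr rfl fun x hx => show _ = quadraticChar F (x + 2 * t) from ?_]
  · rw [show t + 2 * t = 3 * t by ring] at h
    linarith
  · rw [show x ^ 3 + -(3 * t ^ 2) * x + 2 * t ^ 3 = (x - t) ^ 2 * (x + 2 * t) by ring, map_mul,
      quadraticChar_sq_one' (sub_ne_zero.2 (Finset.ne_of_mem_erase hx)), one_mul]

theorem sum_comp_point (hF : ringChar F ≠ 2) (f : F → F → ℤ) :
    ∑ x : F, ∑ y : F, ∑ A : F, f A (y ^ 2 - x ^ 3 - A * x) =
      ∑ A, ∑ B, (Fintype.card F + cubicSum A B) * f A B := by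
  have h : ∀ x A : F, ∑ y : F, f A (y ^ 2 - x ^ 3 - A * x) =
      ∑ B, (quadraticChar F (x ^ 3 + A * x + B) + 1) * f A B := fun x A => by
    rw [sum_comp_sq hF (fun z => f A (z - x ^ 3 - A * x)),
      ← Equiv.sum_comp (Equiv.addLeft (x ^ 3 + A * x))]
    refine Finset.sum_congr rfl fun B _ => ?_
    simp only [Equiv.coe_addLeft]
    congr 2
    ring
  rw [Finset.sum_congr rfl fun x _ => Finset.sum_comm, Finset.sum_comm]
  refine Finset.sum_congr rfl fun A _ => ?_
  simp_rw [h]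
  rw [Finset.sum_comm]
  refine Finset.sum_congr rfl fun B _ => ?_
  rw [← Finset.sum_mul, Finset.sum_add_distrib, cubicSum]
  simp [add_comm]

theorem two_mul_sum_comp_cubicSum_singular (hF : ringChar F ≠ 2) (h3 : (3 : F) ≠ 0) (f : ℤ → ℤ) :
    2 * ∑ t : F, f (cubicSum (-(3 * t ^ 2)) (2 * t ^ 3)) =
      2 * f 0 + ((Fintype.card F : ℤ) - 1) * (f (-1) + f 1) := by
  have h := two_mul_sum_comp_quadraticChar hF fun j => f (-j)
  simp only [neg_neg, neg_zero] at h
  rw [← h]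
  conv_rhs => rw [← sum_comp_affine h3 0]
  simp_rw [cubicSum_singular hF, add_zero]

/-- The eighth moment of the trace of Frobenius over all Weierstrass cubics. -/
theorem sum_cubicSum_pow_eight (h2 : (2 : F) ≠ 0) (h3 : (3 : F) ≠ 0) {q : ℤ}
    (hq : q = Fintype.card F) :
    ∑ A : F, ∑ B : F, cubicSum A B ^ 8 =
      q * (q - 1) * (14 * q ^ 4 - 28 * q ^ 2 - 20 * q - 7) := by
  have hF : ringChar F ≠ 2 := fun h => h2 (by simpa [h] using CharP.cast_eq_zero F (ringChar F))
  have hval : ∀ c x y A : F, (1 + charEsymm 1 (fun s =>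
      (s + c) ^ 4 - 6 * x * (s + c) ^ 2 + 8 * y * (s + c) - 3 * x ^ 2 - 4 * A)) ^ 7 =
      cubicSum A (y ^ 2 - x ^ 3 - A * x) ^ 7 + if y = 0 then if A = -(3 * x ^ 2) then
        (cubicSum A (y ^ 2 - x ^ 3 - A * x) + q) ^ 7 - cubicSum A (y ^ 2 - x ^ 3 - A * x) ^ 7
        else 0 else 0 := by
    intro c x y A
    have shift := Equiv.sum_comp (Equiv.addRight c) (fun s => quadraticChar F
      (s ^ 4 - 6 * x * s ^ 2 + 8 * y * s - 3 * x ^ 2 - 4 * A))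
    simp only [Equiv.coe_addRight] at shift
    rw [charEsymm_one, shift, one_add_sum_quadraticChar_quartic hF, ← hq]
    simp only [add_comm (3 * x ^ 2) A, add_eq_zero_iff_eq_neg]
    by_cases hy : y = 0 <;> by_cases hA : A = -(3 * x ^ 2) <;> simp [hy, hA]
  have hsing : ∀ x : F, ∑ y : F, ∑ A : F, (if y = 0 then if A = -(3 * x ^ 2) then
      (cubicSum A (y ^ 2 - x ^ 3 - A * x) + q) ^ 7 - cubicSum A (y ^ 2 - x ^ 3 - A * x) ^ 7
      else 0 else 0) = (cubicSum (-(3 * x ^ 2)) (2 * x ^ 3) + q) ^ 7 -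
        cubicSum (-(3 * x ^ 2)) (2 * x ^ 3) ^ 7 := by
    intro x
    rw [Finset.sum_eq_single 0 (fun y _ hy => by simp [hy]) (by simp)]
    simp only [if_true, Finset.sum_ite_eq', mem_univ]
    rw [show (0 : F) ^ 2 - x ^ 3 - -(3 * x ^ 2) * x = 2 * x ^ 3 by ring]
  have h := leadSum_four_one_add_pow_seven hF hq
  simp_rw [leadSum_four h2 h3, hval, Finset.sum_add_distrib, hsing] at h
  have hpt := sum_comp_point hF fun A B : F => cubicSum A B ^ 7
  have h7 := sum_cubicSum_pow_odd hF (n := 7) (by decide)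
  have hs := two_mul_sum_comp_cubicSum_singular hF h3 fun j => (j + q) ^ 7 - j ^ 7
  simp_rw [add_mul, ← pow_succ', Finset.sum_add_distrib, ← Finset.mul_sum, h7, mul_zero,
    zero_add] at hpt
  simp_rw [hpt] at h
  simp only [sum_const, card_univ, nsmul_eq_mul, ← hq] at h hs
  have hq0 : q ≠ 0 := by simp [hq]
  refine mul_left_cancel₀ (mul_ne_zero two_ne_zero hq0) ?_
  linear_combination 2 * h - q * hs

theorem sum_cubicSum_pow_eight_discriminant_eq_zero (h2 : (2 : F) ≠ 0) (h3 : (3 : F) ≠ 0) :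
    ∑ AB ∈ univ.filter (fun AB : F × F => 4 * AB.1 ^ 3 + 27 * AB.2 ^ 2 = 0),
      cubicSum AB.1 AB.2 ^ 8 = (Fintype.card F : ℤ) - 1 := by
  have hF : ringChar F ≠ 2 := fun h => h2 (by simpa [h] using CharP.cast_eq_zero F (ringChar F))
  have hs := two_mul_sum_comp_cubicSum_singular hF h3 fun j => j ^ 8
  rw [← Finset.sum_nbij (fun t : F => (-(3 * t ^ 2), 2 * t ^ 3)) (fun t _ => ?_)
    (fun t _ u _ htu => ?_) (fun AB h => ?_) (fun t _ => rfl)]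
  · linarith
  · simp only [mem_filter, mem_univ, true_and]
    ring
  · obtain ⟨e1, e2⟩ := Prod.mk.inj htu
    have e1 : t ^ 2 = u ^ 2 := mul_left_cancel₀ h3 (neg_injective e1)
    have e2 : t ^ 3 = u ^ 3 := mul_left_cancel₀ h2 e2
    by_cases hu : u = 0
    · simpa [hu] using e1
    · refine mul_left_cancel₀ (pow_ne_zero 2 hu) ?_
      linear_combination e2 - t * e1
  · obtain ⟨A, B⟩ := AB
    have h : 4 * A ^ 3 + 27 * B ^ 2 = 0 := by simpa using h
    have h4 : (4 : F) ≠ 0 := by rw [show (4 : F) = 2 * 2 by norm_num]; exact mul_ne_zero h2 h2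
    have h27 : (27 : F) ≠ 0 := by
      rw [show (27 : F) = 3 ^ 3 by norm_num]; exact pow_ne_zero 3 h3
    by_cases hA : A = 0
    · have hB : B = 0 := by simpa [hA, h27] using h
      exact ⟨0, by simp, by simp [hA, hB]⟩
    · refine ⟨-(3 * B) / (2 * A), by simp, Prod.ext ?_ ?_⟩
      · field_simp
        linear_combination (-1) * h
      · field_simp
        linear_combination (-B) * h

end CubicSums

section

variable {F : Type*} [Field F] [Fintype F] [DecidableEq F]

theorem card_weierstrass (hF : ringChar F ≠ 2) (A B : F) :
    (Nat.card {xy : F × F // xy.2 ^ 2 = xy.1 ^ 3 + A * xy.1 + B} : ℤ) =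
      Fintype.card F + cubicSum A B := by
  rw [Nat.card_eq_fintype_card, Fintype.card_subtype, ← Finset.sum_boole, Fintype.sum_prod_type]
  simp_rw [sum_sq_eq hF]
  rw [Finset.sum_add_distrib, cubicSum]
  simp [add_comm]

/-- The eighth moment of the trace of Frobenius over the elliptic curves in short Weierstrass
form. -/
theorem sum_cubicSum_pow_eight_discriminant_ne_zero (h2 : (2 : F) ≠ 0) (h3 : (3 : F) ≠ 0) {q : ℤ}
    (hq : q = Fintype.card F) :
    ∑ AB ∈ univ.filter (fun AB : F × F => 4 * AB.1 ^ 3 + 27 * AB.2 ^ 2 ≠ 0),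
      cubicSum AB.1 AB.2 ^ 8 =
        (14 * q ^ 5 - 28 * q ^ 3 - 20 * q ^ 2 - 7 * q - 1) * (q - 1) := by
  have h := Finset.sum_filter_add_sum_filter_not univ
    (fun AB : F × F => 4 * AB.1 ^ 3 + 27 * AB.2 ^ 2 = 0) (fun AB => cubicSum AB.1 AB.2 ^ 8)
  rw [sum_cubicSum_pow_eight_discriminant_eq_zero h2 h3, Fintype.sum_prod_type,
    sum_cubicSum_pow_eight h2 h3 hq, ← hq] at h
  linear_combination h

end

end QuadraticCharacterMoments

/-- **Birch's formula** `M₈(a_p) = 14p⁴ - 28p² - 20p - 7 - p⁻¹` for a prime `p ≥ 5`: the sum of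
`a_p(A,B)^8` over all pairs `(A,B) ∈ (ℤ/pℤ)²` with `4A³ + 27B² ≠ 0` equals
`14 * (p : ℤ) ^ 5 - 28 * (p : ℤ) ^ 3 - 20 * (p : ℤ) ^ 2 - 7 * (p : ℤ) - 1`, where `a_p(A,B) = p - #{(x,y) : y² = x³ + Ax + B}`. -/
theorem birch_eighth_moment (p : ℕ) [Fact p.Prime] (hp5 : 5 ≤ p) :
    ∑ AB ∈ Finset.univ.filter
        (fun AB : ZMod p × ZMod p => 4 * AB.1 ^ 3 + 27 * AB.2 ^ 2 ≠ 0),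
      ((p : ℤ) -
        (Nat.card {xy : ZMod p × ZMod p //
          xy.2 ^ 2 = xy.1 ^ 3 + AB.1 * xy.1 + AB.2} : ℤ)) ^ 8 =
      (14 * (p : ℤ) ^ 5 - 28 * (p : ℤ) ^ 3 - 20 * (p : ℤ) ^ 2 - 7 * (p : ℤ) - 1) * ((p : ℤ) - 1) := by
  have hn : ∀ n : ℕ, 0 < n → n < 5 → ((n : ℕ) : ZMod p) ≠ 0 := fun n h0 h5 h =>
    absurd (Nat.le_of_dvd h0 ((ZMod.natCast_eq_zero_iff n p).1 h)) (by omega)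
  have h2 : (2 : ZMod p) ≠ 0 := by simpa using hn 2 (by norm_num) (by norm_num)
  have h3 : (3 : ZMod p) ≠ 0 := by simpa using hn 3 (by norm_num) (by norm_num)
  have hF : ringChar (ZMod p) ≠ 2 := by
    rw [ZMod.ringChar_zmod_n]
    omega
  rw [← sum_cubicSum_pow_eight_discriminant_ne_zero h2 h3 (by rw [ZMod.card])]
  refine Finset.sum_congr rfl fun AB _ => ?_
  rw [card_weierstrass hF, ZMod.card, sub_add_cancel_left, Even.neg_pow (by decide)]
end

section
/- Let μ be the Haar probability measure on the compact group SU(2). Then the pushforward of μ under the map U ↦ Re(trace U) is the measure on ℝ that is absolutely continuous with respect to Lebesgue measure with density t ↦ (1/(2π))·√(4 - t²) on the interval [-2, 2] and 0 outside it (the semicircle distribution). -/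
open MeasureTheory

noncomputable instance : MeasurableSpace (Matrix (Fin 2) (Fin 2) ℂ) := borel _

instance : BorelSpace (Matrix (Fin 2) (Fin 2) ℂ) := ⟨rfl⟩

open Filter Topology Set in
/-- If the law of `(X, Y)` has the same mixed moments after every plane rotation, then the
infinitesimal rotation of `X ^ (n + 1) * Y` has mean zero. -/
theorem integral_pow_mul_sq_of_rotation_invariant {Ω : Type*} [MeasurableSpace Ω]
    {μ : Measure Ω} [IsFiniteMeasure μ] {X Y : Ω → ℝ} {C : ℝ}
    (hX : AEStronglyMeasurable X μ) (hY : AEStronglyMeasurable Y μ)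
    (hXC : ∀ᵐ ω ∂μ, |X ω| ≤ C) (hYC : ∀ᵐ ω ∂μ, |Y ω| ≤ C) (n : ℕ)
    (hrot : ∀ θ : ℝ, ∫ ω, (Real.cos θ * X ω + Real.sin θ * Y ω) ^ (n + 1) *
      (Real.cos θ * Y ω - Real.sin θ * X ω) ∂μ = ∫ ω, X ω ^ (n + 1) * Y ω ∂μ) :
    ∫ ω, ((n + 1) * (X ω ^ n * Y ω ^ 2) - X ω ^ (n + 2)) ∂μ = 0 := by
  have hbd : ∀ᵐ ω ∂μ, ∀ θ : ℝ, |Real.cos θ * X ω + Real.sin θ * Y ω| ≤ 2 * C ∧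
      |Real.cos θ * Y ω - Real.sin θ * X ω| ≤ 2 * C := by
    filter_upwards [hXC, hYC] with ω h1 h2 θ
    have hc := Real.abs_cos_le_one θ
    have hs := Real.abs_sin_le_one θ
    have aux : ∀ a b : ℝ, |a| ≤ 1 → |b| ≤ C → |a * b| ≤ C := fun a b ha hb => by
      rw [abs_mul]
      nlinarith [abs_nonneg a, abs_nonneg b]
    constructor
    · linarith [abs_add_le (Real.cos θ * X ω) (Real.sin θ * Y ω), aux _ _ hc h1, aux _ _ hs h2]
    · linarith [abs_sub (Real.cos θ * Y ω) (Real.sin θ * X ω), aux _ _ hc h2, aux _ _ hs h1]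
  have key := hasDerivAt_integral_of_dominated_loc_of_deriv_le (μ := μ) (s := univ) (x₀ := (0 : ℝ))
    (F := fun θ ω => (Real.cos θ * X ω + Real.sin θ * Y ω) ^ (n + 1) *
      (Real.cos θ * Y ω - Real.sin θ * X ω))
    (F' := fun θ ω => (n + 1) * ((Real.cos θ * X ω + Real.sin θ * Y ω) ^ n *
      (Real.cos θ * Y ω - Real.sin θ * X ω) ^ 2) -
        (Real.cos θ * X ω + Real.sin θ * Y ω) ^ (n + 2))
    (bound := fun _ => (n + 1) * ((2 * C) ^ n * (2 * C) ^ 2) + (2 * C) ^ (n + 2))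
    univ_mem (Eventually.of_forall fun θ => by fun_prop) ?_ (by fun_prop) ?_
    (integrable_const _) ?_
  · have h0 : HasDerivAt (fun θ : ℝ => ∫ ω, (Real.cos θ * X ω + Real.sin θ * Y ω) ^ (n + 1) *
        (Real.cos θ * Y ω - Real.sin θ * X ω) ∂μ) 0 0 := by
      simp only [hrot]
      exact hasDerivAt_const _ _
    simpa using key.2.unique h0
  · refine Integrable.of_bound (by fun_prop) ((2 * C) ^ (n + 1) * (2 * C)) ?_
    filter_upwards [hbd] with ω h
    obtain ⟨h1, h2⟩ := h 0
    have hC : 0 ≤ 2 * C := (abs_nonneg _).trans h1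
    rw [norm_mul, norm_pow, Real.norm_eq_abs, Real.norm_eq_abs]
    gcongr
  · filter_upwards [hbd] with ω h θ _
    obtain ⟨h1, h2⟩ := h θ
    refine (norm_sub_le _ _).trans ?_
    have hC : 0 ≤ 2 * C := (abs_nonneg _).trans h1
    rw [norm_mul, norm_mul, norm_pow, norm_pow, norm_pow, Real.norm_eq_abs, Real.norm_eq_abs,
      Real.norm_eq_abs, abs_of_nonneg (by positivity : (0 : ℝ) ≤ n + 1)]
    gcongr
  · refine Eventually.of_forall fun ω θ _ => ?_
    have hA : HasDerivAt (fun θ => Real.cos θ * X ω + Real.sin θ * Y ω)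
        (-Real.sin θ * X ω + Real.cos θ * Y ω) θ :=
      ((Real.hasDerivAt_cos θ).mul_const _).add ((Real.hasDerivAt_sin θ).mul_const _)
    have hB : HasDerivAt (fun θ => Real.cos θ * Y ω - Real.sin θ * X ω)
        (-Real.sin θ * Y ω - Real.cos θ * X ω) θ :=
      ((Real.hasDerivAt_cos θ).mul_const _).sub ((Real.hasDerivAt_sin θ).mul_const _)
    refine ((hA.fun_pow (n + 1)).mul hB).congr_deriv ?_
    push_cast
    ring

open Polynomial Set in
/-- Finite measures concentrated on a compact interval are determined by their moments. -/
theorem MeasureTheory.Measure.ext_of_integral_pow_eq {ν₁ ν₂ : Measure ℝ} [IsFiniteMeasure ν₁]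
    [IsFiniteMeasure ν₂] {a b : ℝ} (h₁ : ∀ᵐ x ∂ν₁, x ∈ Icc a b) (h₂ : ∀ᵐ x ∂ν₂, x ∈ Icc a b)
    (h : ∀ n : ℕ, ∫ x, x ^ n ∂ν₁ = ∫ x, x ^ n ∂ν₂) : ν₁ = ν₂ := by
  have hintegrable : ∀ (ν : Measure ℝ) [IsFiniteMeasure ν], (∀ᵐ x ∂ν, x ∈ Icc a b) →
      ∀ g : ℝ → ℝ, Continuous g → Integrable g ν := by
    intro ν _ hν g hg
    obtain ⟨C, hC⟩ := (isCompact_Icc (a := a) (b := b)).exists_bound_of_continuousOn hg.continuousOn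
    exact Integrable.of_bound hg.aestronglyMeasurable C (hν.mono hC)
  have hpoly : ∀ p : ℝ[X], ∫ x, p.eval x ∂ν₁ = ∫ x, p.eval x ∂ν₂ := by
    intro p
    simp only [Polynomial.eval_eq_sum_range]
    rw [integral_finsetSum _ fun i _ => hintegrable ν₁ h₁ _ (by fun_prop),
      integral_finsetSum _ fun i _ => hintegrable ν₂ h₂ _ (by fun_prop)]
    simp only [integral_const_mul, h]
  refine ext_of_forall_integral_eq_of_IsFiniteMeasure fun f => ?_
  have hclose : ∀ (ν : Measure ℝ) [IsFiniteMeasure ν], (∀ᵐ x ∂ν, x ∈ Icc a b) →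
      ∀ (p : ℝ[X]) (ε : ℝ), (∀ x ∈ Icc a b, |p.eval x - f x| < ε) →
        |∫ x, p.eval x ∂ν - ∫ x, f x ∂ν| ≤ ε * ν.real univ := by
    intro ν _ hν p ε hp
    rw [← integral_sub (hintegrable ν hν _ p.continuous) (hintegrable ν hν _ f.continuous)]
    exact norm_integral_le_of_norm_le_const (f := fun x => p.eval x - f x)
      (hν.mono fun x hx => (hp x hx).le)
  refine eq_of_abs_sub_le_all fun δ hδ => ?_
  have hM : 0 < ν₁.real univ + ν₂.real univ + 1 := by positivity
  obtain ⟨p, hp⟩ := exists_polynomial_near_of_continuousOn a b f f.continuous.continuousOn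
    (δ / (ν₁.real univ + ν₂.real univ + 1)) (by positivity)
  have e₁ := hclose ν₁ h₁ p _ hp
  have e₂ := hclose ν₂ h₂ p _ hp
  rw [hpoly p] at e₁
  have e₃ : δ / (ν₁.real univ + ν₂.real univ + 1) * (ν₁.real univ + ν₂.real univ + 1) = δ :=
    div_mul_cancel₀ _ hM.ne'
  have e₄ : 0 < δ / (ν₁.real univ + ν₂.real univ + 1) := by positivity
  rw [abs_le] at *
  constructor <;> nlinarith

theorem integral_sqrt_four_sub_sq : ∫ t in (-2 : ℝ)..2, √(4 - t ^ 2) = 2 * Real.pi := by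
  have h := intervalIntegral.integral_comp_mul_left (a := -1) (b := 1)
    (fun t : ℝ => √(4 - t ^ 2)) (c := 2) two_ne_zero
  have h' : ∀ x : ℝ, √(4 - (2 * x) ^ 2) = 2 * √(1 - x ^ 2) := fun x => by
    rw [show 4 - (2 * x) ^ 2 = 2 ^ 2 * (1 - x ^ 2) by ring, Real.sqrt_mul (by positivity),
      Real.sqrt_sq (by positivity)]
  simp only [h', intervalIntegral.integral_const_mul, integral_sqrt_one_sub_sq, smul_eq_mul] at h
  norm_num at h
  linarith

theorem hasDerivAt_four_sub_sq_mul_sqrt {t : ℝ} (ht : t ∈ Set.Ioo (-2 : ℝ) 2) :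
    HasDerivAt (fun t : ℝ => (4 - t ^ 2) * √(4 - t ^ 2)) (-3 * (t * √(4 - t ^ 2))) t := by
  have hpos : 0 < 4 - t ^ 2 := by nlinarith [ht.1, ht.2]
  have h1 : HasDerivAt (fun t : ℝ => 4 - t ^ 2) (-(2 * t)) t := by
    simpa using (hasDerivAt_pow 2 t).const_sub 4
  refine (h1.mul (h1.sqrt hpos.ne')).congr_deriv ?_
  have hs : √(4 - t ^ 2) ≠ 0 := (Real.sqrt_pos.2 hpos).ne'
  field_simp
  rw [Real.sq_sqrt hpos.le]
  ring

theorem integral_mul_sqrt_four_sub_sq : ∫ t in (-2 : ℝ)..2, t * √(4 - t ^ 2) = 0 := by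
  have h := intervalIntegral.integral_eq_sub_of_hasDerivAt_of_le (a := -2) (b := 2) (by norm_num)
    (by fun_prop) (fun t ht => hasDerivAt_four_sub_sq_mul_sqrt ht)
    (Continuous.intervalIntegrable (by fun_prop) _ _)
  rw [intervalIntegral.integral_const_mul] at h
  norm_num at h
  exact h

theorem integral_pow_mul_sqrt_four_sub_sq_succ_succ (n : ℕ) :
    (n + 4) * ∫ t in (-2 : ℝ)..2, t ^ (n + 2) * √(4 - t ^ 2) =
      4 * (n + 1) * ∫ t in (-2 : ℝ)..2, t ^ n * √(4 - t ^ 2) := by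
  have h := intervalIntegral.integral_eq_sub_of_hasDerivAt_of_le (a := -2) (b := 2)
    (f := fun t : ℝ => t ^ (n + 1) * ((4 - t ^ 2) * √(4 - t ^ 2)))
    (f' := fun t : ℝ => 4 * (n + 1) * (t ^ n * √(4 - t ^ 2)) -
      (n + 4) * (t ^ (n + 2) * √(4 - t ^ 2))) (by norm_num)
    (by fun_prop) (fun t ht => ?_) (Continuous.intervalIntegrable (by fun_prop) _ _)
  · rw [intervalIntegral.integral_sub (Continuous.intervalIntegrable (by fun_prop) _ _)
      (Continuous.intervalIntegrable (by fun_prop) _ _), intervalIntegral.integral_const_mul,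
      intervalIntegral.integral_const_mul] at h
    norm_num at h
    linarith
  · refine ((hasDerivAt_pow (n + 1) t).mul (hasDerivAt_four_sub_sq_mul_sqrt ht)).congr_deriv ?_
    push_cast
    ring

/-- A sequence is determined by its first two terms and the moment recursion of the semicircle
law. -/
theorem eq_of_semicircle_recursion {u v : ℕ → ℝ} (h0 : u 0 = v 0) (h1 : u 1 = v 1)
    (hu : ∀ n : ℕ, (n + 4) * u (n + 2) = 4 * (n + 1) * u n)
    (hv : ∀ n : ℕ, (n + 4) * v (n + 2) = 4 * (n + 1) * v n) (n : ℕ) : u n = v n := by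
  induction n using Nat.twoStepInduction with
  | zero => exact h0
  | one => exact h1
  | more n ih _ =>
    have : (n + 4 : ℝ) ≠ 0 := by positivity
    refine mul_left_cancel₀ this ?_
    rw [hu, hv, ih]

noncomputable def semicircleDensity (t : ℝ) : ℝ := (1 / (2 * Real.pi)) * √(4 - t ^ 2)

theorem continuous_semicircleDensity : Continuous semicircleDensity := by
  unfold semicircleDensity
  fun_prop

theorem semicircleDensity_nonneg (t : ℝ) : 0 ≤ semicircleDensity t := by
  have := Real.pi_pos
  unfold semicircleDensity
  positivity

theorem semicircleDensity_eq_zero {t : ℝ} (ht : t ∉ Set.Ioc (-2 : ℝ) 2) :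
    semicircleDensity t = 0 := by
  have : 4 - t ^ 2 ≤ 0 := by
    by_contra! h
    exact ht ⟨by nlinarith, by nlinarith⟩
  rw [semicircleDensity, Real.sqrt_eq_zero_of_nonpos this, mul_zero]

theorem integrable_semicircleDensity : Integrable semicircleDensity := by
  refine (continuous_semicircleDensity.integrable_of_hasCompactSupport ?_)
  refine HasCompactSupport.intro (isCompact_Icc (a := (-2 : ℝ)) (b := 2)) fun t ht => ?_
  exact semicircleDensity_eq_zero fun h => ht (Set.Ioc_subset_Icc_self h)

noncomputable def semicircleMeasure : Measure ℝ :=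
  volume.withDensity fun t => ENNReal.ofReal (semicircleDensity t)

instance : IsFiniteMeasure semicircleMeasure :=
  isFiniteMeasure_withDensity_ofReal integrable_semicircleDensity.2

theorem ae_semicircleMeasure_mem_Icc : ∀ᵐ t ∂semicircleMeasure, t ∈ Set.Icc (-2 : ℝ) 2 := by
  rw [semicircleMeasure, ae_withDensity_iff
    (continuous_semicircleDensity.measurable.ennreal_ofReal)]
  refine Filter.Eventually.of_forall fun t ht => ?_
  by_contra hmem
  exact ht (by rw [semicircleDensity_eq_zero fun h => hmem (Set.Ioc_subset_Icc_self h),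
    ENNReal.ofReal_zero])

theorem integral_pow_semicircleMeasure (n : ℕ) :
    ∫ t, t ^ n ∂semicircleMeasure =
      (1 / (2 * Real.pi)) * ∫ t in (-2 : ℝ)..2, t ^ n * √(4 - t ^ 2) := by
  rw [semicircleMeasure, integral_withDensity_eq_integral_toReal_smul
    (continuous_semicircleDensity.measurable.ennreal_ofReal)
    (Filter.Eventually.of_forall fun _ => ENNReal.ofReal_lt_top),
    ← intervalIntegral.integral_const_mul, intervalIntegral.integral_of_le (by norm_num),
    ← setIntegral_eq_integral_of_forall_compl_eq_zero (s := Set.Ioc (-2 : ℝ) 2)]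
  · congr 1
    ext t
    rw [ENNReal.toReal_ofReal (semicircleDensity_nonneg t), semicircleDensity, smul_eq_mul]
    ring
  · intro t ht
    simp [semicircleDensity_eq_zero ht]

/-- The sum of the squares of the quaternion coordinates of a matrix in `SU(2)`, each scaled by
two. -/
theorem sum_sq_trace_of_mem_su2 {U : Matrix (Fin 2) (Fin 2) ℂ} (hU : star U * U = 1)
    (hdet : U.det = 1) :
    (Matrix.trace U).re ^ 2 + (Matrix.trace (!![Complex.I, 0; 0, -Complex.I] * U)).re ^ 2 +
      (Matrix.trace (!![0, 1; -1, 0] * U)).re ^ 2 +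
      (Matrix.trace (!![0, Complex.I; Complex.I, 0] * U)).re ^ 2 = 4 := by
  have hadj : star U = U.adjugate := by
    have h : U * U.adjugate = 1 := by rw [Matrix.mul_adjugate, hdet, one_smul]
    calc star U = star U * (U * U.adjugate) := by rw [h, mul_one]
      _ = U.adjugate := by rw [← mul_assoc, hU, one_mul]
  rw [Matrix.adjugate_fin_two] at hadj
  have h1 : star (U 0 0) = U 1 1 := by simpa using congrFun (congrFun hadj 0) 0
  have h2 : star (U 1 0) = -U 0 1 := by simpa using congrFun (congrFun hadj 0) 1
  rw [Matrix.det_fin_two] at hdet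
  rw [Complex.ext_iff] at h1 h2 hdet
  simp at h1 h2 hdet
  simp only [Matrix.trace_fin_two, Matrix.mul_apply, Fin.sum_univ_two]
  simp
  obtain ⟨h11, h12⟩ := h1
  obtain ⟨h21, h22⟩ := h2
  have h23 : (U 0 1).re = -(U 1 0).re := by linarith
  obtain ⟨hre, -⟩ := hdet
  rw [← h11, ← h12, h23, ← h22] at *
  linarith

/-- The moment identity obtained by rotating in the plane spanned by `1` and an imaginary unit
quaternion `u`. -/
theorem integral_trace_pow_mul_sq_of_left_invariant {μ : Measure (Matrix (Fin 2) (Fin 2) ℂ)}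
    [IsProbabilityMeasure μ]
    (hinv : ∀ V : Matrix (Fin 2) (Fin 2) ℂ, star V * V = 1 → V.det = 1 →
      Measure.map (fun U => V * U) μ = μ)
    {u : Matrix (Fin 2) (Fin 2) ℂ} (hstar : star u = -u) (husq : u * u = -1) (hdet : u.det = 1)
    (htr : u.trace = 0)
    (hT : ∀ᵐ U ∂μ, |(Matrix.trace U).re| ≤ 2) (hS : ∀ᵐ U ∂μ, |(Matrix.trace (u * U)).re| ≤ 2)
    (n : ℕ) :
    ∫ U, ((n + 1) * ((Matrix.trace U).re ^ n * (Matrix.trace (u * U)).re ^ 2) -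
      (Matrix.trace U).re ^ (n + 2)) ∂μ = 0 := by
  have hTc : Continuous fun U : Matrix (Fin 2) (Fin 2) ℂ => (Matrix.trace U).re := by fun_prop
  have hSc : Continuous fun U : Matrix (Fin 2) (Fin 2) ℂ => (Matrix.trace (u * U)).re := by
    fun_prop
  refine integral_pow_mul_sq_of_rotation_invariant hTc.aestronglyMeasurable
    hSc.aestronglyMeasurable hT hS n fun θ => ?_
  set V : Matrix (Fin 2) (Fin 2) ℂ := (Real.cos θ : ℂ) • 1 + (Real.sin θ : ℂ) • u with hV
  have hcs : (Real.cos θ : ℂ) ^ 2 + (Real.sin θ : ℂ) ^ 2 = 1 := by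
    exact_mod_cast Real.cos_sq_add_sin_sq θ
  have hVstar : star V * V = 1 := by
    have : star V = (Real.cos θ : ℂ) • 1 - (Real.sin θ : ℂ) • u := by
      rw [hV, star_add, star_smul, star_smul, star_one, hstar, smul_neg, ← sub_eq_add_neg]
      simp only [RCLike.star_def, Complex.conj_ofReal]
    rw [this, hV, sub_mul, mul_add, mul_add]
    simp only [smul_mul_assoc, mul_smul_comm, one_mul, mul_one, husq, smul_neg]
    nth_rewrite 3 [← one_smul ℂ (1 : Matrix (Fin 2) (Fin 2) ℂ)]
    match_scalars
    · push_cast at hcs ⊢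
      linear_combination hcs
    · ring
  have hVdet : V.det = 1 := by
    rw [Matrix.det_fin_two] at hdet ⊢
    rw [Matrix.trace_fin_two] at htr
    simp only [hV, Matrix.add_apply, Matrix.smul_apply, Matrix.one_apply, smul_eq_mul]
    simp only [one_ne_zero, zero_ne_one, if_true, if_false]
    linear_combination (Real.cos θ : ℂ) * (Real.sin θ : ℂ) * htr + (Real.sin θ : ℂ) ^ 2 * hdet + hcs
  have h1 : ∀ U, (Matrix.trace (V * U)).re =
      Real.cos θ * (Matrix.trace U).re + Real.sin θ * (Matrix.trace (u * U)).re := fun U => by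
    rw [hV, add_mul, smul_mul_assoc, smul_mul_assoc, one_mul, Matrix.trace_add, Matrix.trace_smul,
      Matrix.trace_smul, smul_eq_mul, smul_eq_mul, Complex.add_re, Complex.re_ofReal_mul,
      Complex.re_ofReal_mul]
  have h2 : ∀ U, (Matrix.trace (u * (V * U))).re =
      Real.cos θ * (Matrix.trace (u * U)).re - Real.sin θ * (Matrix.trace U).re := fun U => by
    rw [← mul_assoc, hV, mul_add, mul_smul_comm, mul_smul_comm, mul_one, husq, add_mul,
      smul_mul_assoc, smul_mul_assoc, neg_one_mul, Matrix.trace_add, Matrix.trace_smul,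
      Matrix.trace_smul, Matrix.trace_neg, smul_eq_mul, smul_eq_mul, Complex.add_re,
      Complex.re_ofReal_mul, Complex.re_ofReal_mul, Complex.neg_re, mul_neg, ← sub_eq_add_neg]
  have hVc : Continuous fun U : Matrix (Fin 2) (Fin 2) ℂ => V * U := by fun_prop
  have hmap := integral_map (μ := μ) hVc.measurable.aemeasurable
    (f := fun U => (Matrix.trace U).re ^ (n + 1) * (Matrix.trace (u * U)).re)
    (((hTc.pow _).mul hSc).aestronglyMeasurable)
  rw [hinv V hVstar hVdet] at hmap
  simp only [h1, h2] at hmap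
  exact hmap.symm

/-- The trace moments of the Haar measure satisfy the recursion of the semicircle law. -/
theorem integral_trace_pow_succ_succ_of_left_invariant
    {μ : Measure (Matrix (Fin 2) (Fin 2) ℂ)} [IsProbabilityMeasure μ]
    (hsupp : ∀ᵐ U ∂μ, star U * U = 1 ∧ U.det = 1)
    (hinv : ∀ V : Matrix (Fin 2) (Fin 2) ℂ, star V * V = 1 → V.det = 1 →
      Measure.map (fun U => V * U) μ = μ) (n : ℕ) :
    (n + 4) * ∫ U, (Matrix.trace U).re ^ (n + 2) ∂μ =
      4 * (n + 1) * ∫ U, (Matrix.trace U).re ^ n ∂μ := by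
  have hsum := hsupp.mono fun U hU => sum_sq_trace_of_mem_su2 hU.1 hU.2
  have hT : ∀ᵐ U ∂μ, |(Matrix.trace U).re| ≤ 2 := hsum.mono fun U hU =>
    abs_le_of_sq_le_sq (by nlinarith) (by norm_num)
  have hpow : ∀ m : ℕ, Integrable (fun U : Matrix (Fin 2) (Fin 2) ℂ => (Matrix.trace U).re ^ m) μ :=
    fun m => Integrable.of_bound (Continuous.aestronglyMeasurable (by fun_prop)) (2 ^ m) <|
      hT.mono fun U hU => by
        rw [norm_pow, Real.norm_eq_abs]
        gcongr
  have hintegrable : ∀ u : Matrix (Fin 2) (Fin 2) ℂ, (∀ᵐ U ∂μ, |(Matrix.trace (u * U)).re| ≤ 2) →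
      Integrable (fun U => ((n : ℝ) + 1) * ((Matrix.trace U).re ^ n * (Matrix.trace (u * U)).re ^ 2) -
        (Matrix.trace U).re ^ (n + 2)) μ := by
    intro u hu
    refine (Integrable.const_mul ?_ _).sub (hpow _)
    refine Integrable.of_bound (Continuous.aestronglyMeasurable (by fun_prop)) (2 ^ n * 2 ^ 2) ?_
    filter_upwards [hT, hu] with U h1 h2
    rw [norm_mul, norm_pow, norm_pow, Real.norm_eq_abs, Real.norm_eq_abs]
    gcongr
  have hI : ∀ᵐ U ∂μ, |(Matrix.trace (!![Complex.I, 0; 0, -Complex.I] * U)).re| ≤ 2 :=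
    hsum.mono fun U hU => abs_le_of_sq_le_sq (by nlinarith) (by norm_num)
  have hJ : ∀ᵐ U ∂μ, |(Matrix.trace (!![0, 1; -1, 0] * U)).re| ≤ 2 :=
    hsum.mono fun U hU => abs_le_of_sq_le_sq (by nlinarith) (by norm_num)
  have hK : ∀ᵐ U ∂μ, |(Matrix.trace (!![0, Complex.I; Complex.I, 0] * U)).re| ≤ 2 :=
    hsum.mono fun U hU => abs_le_of_sq_le_sq (by nlinarith) (by norm_num)
  have eI := integral_trace_pow_mul_sq_of_left_invariant hinv
    (u := !![Complex.I, 0; 0, -Complex.I]) (by ext i j; fin_cases i <;> fin_cases j <;> simp)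
    (by ext i j; fin_cases i <;> fin_cases j <;> simp) (by simp [Matrix.det_fin_two])
    (by simp [Matrix.trace_fin_two]) hT hI n
  have eJ := integral_trace_pow_mul_sq_of_left_invariant hinv
    (u := !![0, 1; -1, 0]) (by ext i j; fin_cases i <;> fin_cases j <;> simp)
    (by ext i j; fin_cases i <;> fin_cases j <;> simp) (by simp [Matrix.det_fin_two])
    (by simp [Matrix.trace_fin_two]) hT hJ n
  have eK := integral_trace_pow_mul_sq_of_left_invariant hinv
    (u := !![0, Complex.I; Complex.I, 0]) (by ext i j; fin_cases i <;> fin_cases j <;> simp)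
    (by ext i j; fin_cases i <;> fin_cases j <;> simp) (by simp [Matrix.det_fin_two])
    (by simp [Matrix.trace_fin_two]) hT hK n
  have hadd := integral_add ((hintegrable _ hI).add (hintegrable _ hJ)) (hintegrable _ hK)
  simp only [Pi.add_apply] at hadd
  rw [integral_add (hintegrable _ hI) (hintegrable _ hJ), eI, eJ, eK] at hadd
  have hcongr : ∫ U, (4 * (n + 1) * (Matrix.trace U).re ^ n -
      (n + 4) * (Matrix.trace U).re ^ (n + 2)) ∂μ = 0 := by
    rw [← show (0 : ℝ) + 0 + 0 = 0 by norm_num, ← hadd]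
    refine integral_congr_ae ?_
    filter_upwards [hsum] with U hU
    linear_combination -((n + 1) * (Matrix.trace U).re ^ n) * hU
  rw [integral_sub ((hpow _).const_mul _) ((hpow _).const_mul _), integral_const_mul,
    integral_const_mul] at hcongr
  linarith

theorem integral_trace_of_left_invariant {μ : Measure (Matrix (Fin 2) (Fin 2) ℂ)}
    (hinv : ∀ V : Matrix (Fin 2) (Fin 2) ℂ, star V * V = 1 → V.det = 1 →
      Measure.map (fun U => V * U) μ = μ) :
    ∫ U, (Matrix.trace U).re ∂μ = 0 := by
  have hc : Continuous fun U : Matrix (Fin 2) (Fin 2) ℂ => -1 * U := by fun_prop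
  have h := integral_map (μ := μ) hc.measurable.aemeasurable
    (f := fun U => (Matrix.trace U).re) (Continuous.aestronglyMeasurable (by fun_prop))
  rw [hinv (-1) (by simp) (by simp [Matrix.det_fin_two])] at h
  simp only [neg_one_mul, Matrix.trace_neg, Complex.neg_re, integral_neg] at h
  linarith

/-- Let `μ` be the Haar probability measure on the compact group `SU(2)` (realized as a
probability measure on `2×2` complex matrices concentrated on `SU(2)` and invariant
under left translation by elements of `SU(2)`).  Then the pushforward of `μ` under
`U ↦ Re(trace U)` is the semicircle distribution: the measure on `ℝ` with density
`t ↦ (1/(2π))·√(4 - t²)` (which vanishes outside `[-2, 2]`) with respect to Lebesgue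
measure. -/
theorem su2_haar_trace_semicircle (μ : Measure (Matrix (Fin 2) (Fin 2) ℂ))
    [IsProbabilityMeasure μ]
    (hsupp : μ {U : Matrix (Fin 2) (Fin 2) ℂ | ¬(star U * U = 1 ∧ U.det = 1)} = 0)
    (hinv : ∀ V : Matrix (Fin 2) (Fin 2) ℂ, star V * V = 1 → V.det = 1 →
      Measure.map (fun U => V * U) μ = μ) :
    Measure.map (fun U : Matrix (Fin 2) (Fin 2) ℂ => (Matrix.trace U).re) μ =
      volume.withDensity
        (fun t : ℝ => ENNReal.ofReal ((1 / (2 * Real.pi)) * Real.sqrt (4 - t ^ 2))) := by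
  have hae : ∀ᵐ U ∂μ, star U * U = 1 ∧ U.det = 1 := ae_iff.2 hsupp
  have hc : Continuous fun U : Matrix (Fin 2) (Fin 2) ℂ => (Matrix.trace U).re := by fun_prop
  change _ = semicircleMeasure
  have : IsProbabilityMeasure
      (Measure.map (fun U : Matrix (Fin 2) (Fin 2) ℂ => (Matrix.trace U).re) μ) :=
    Measure.isProbabilityMeasure_map hc.measurable.aemeasurable
  refine Measure.ext_of_integral_pow_eq (a := -2) (b := 2) ?_ ae_semicircleMeasure_mem_Icc ?_
  · refine (ae_map_iff hc.measurable.aemeasurable measurableSet_Icc).2 ?_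
    filter_upwards [hae] with U hU
    have := sum_sq_trace_of_mem_su2 hU.1 hU.2
    exact abs_le.1 (abs_le_of_sq_le_sq (by nlinarith) (by norm_num))
  · have hmap : ∀ n : ℕ, ∫ x, x ^ n
        ∂(Measure.map (fun U : Matrix (Fin 2) (Fin 2) ℂ => (Matrix.trace U).re) μ) =
        ∫ U, (Matrix.trace U).re ^ n ∂μ := fun n =>
      integral_map hc.measurable.aemeasurable (by fun_prop)
    refine eq_of_semicircle_recursion ?_ ?_ (fun n => ?_) fun n => ?_
    · rw [hmap, integral_pow_semicircleMeasure]
      simp only [pow_zero, one_mul, integral_const, probReal_univ, smul_eq_mul,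
        integral_sqrt_four_sub_sq]
      have := Real.pi_pos.ne'
      field_simp
    · rw [hmap, integral_pow_semicircleMeasure]
      simp only [pow_one, integral_trace_of_left_invariant hinv, integral_mul_sqrt_four_sub_sq,
        mul_zero]
    · rw [hmap, hmap]
      exact integral_trace_pow_succ_succ_of_left_invariant hae hinv n
    · rw [integral_pow_semicircleMeasure, integral_pow_semicircleMeasure, mul_left_comm,
        integral_pow_mul_sqrt_four_sub_sq_succ_succ, mul_left_comm]
end

section
/- Let g ≥ 1 and let U, V be 2g×2g complex matrices that are both unitary (U⋆U = 1, V⋆V = 1) and symplectic (Uᵀ·J·U = J and Vᵀ·J·V = J for the standard symplectic matrix J). If U and V have the same characteristic polynomial, then there exists a 2g×2g complex matrix W that is unitary and symplectic with W⁻¹·U·W = V. That is, the characteristic polynomial map on conjugacy classes of the unitary symplectic group USp(2g) is injective. -/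
/-- The standard symplectic `2g×2g` matrix, in block form `((0, 1), (-1, 0))` with
`g×g` blocks (rows and columns indexed by `Fin g ⊕ Fin g`). -/
def stdSymplJ (g : ℕ) : Matrix (Fin g ⊕ Fin g) (Fin g ⊕ Fin g) ℂ :=
  Matrix.fromBlocks 0 1 (-1) 0

open Polynomial in
/-- Every complex function agrees on a finite set with a polynomial. -/
theorem Set.Finite.exists_polynomial_eval_eq {s : Set ℂ} (hs : s.Finite) (f : ℂ → ℂ) :
    ∃ p : ℂ[X], ∀ z ∈ s, p.eval z = f z := by
  refine ⟨Lagrange.interpolate hs.toFinset id f, fun z hz => ?_⟩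
  exact Lagrange.eval_interpolate_at_node (v := id) f Function.injective_id.injOn
    (hs.mem_toFinset.2 hz)

/-- Two families of elements that agree as multisets differ by a permutation of the indices. -/
theorem exists_perm_comp_eq_of_map_univ_eq {ι α : Type*} [Fintype ι] (u v : ι → α)
    (h : Finset.univ.val.map u = Finset.univ.val.map v) : ∃ σ : Equiv.Perm ι, u ∘ σ = v := by
  classical
  have hfib (c : α) : Nonempty ({i // v i = c} ≃ {i // u i = c}) := by
    refine ⟨Fintype.equivOfCardEq ?_⟩
    have := congrArg (Multiset.count c) h
    rw [Multiset.count_map, Multiset.count_map] at this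
    rw [Fintype.card_subtype, Fintype.card_subtype]
    simpa [Finset.card, eq_comm] using this.symm
  refine ⟨Equiv.ofFiberEquiv fun c => (hfib c).some, ?_⟩
  ext i
  exact Equiv.ofFiberEquiv_map _ i

namespace Matrix

open Polynomial

open scoped Matrix.Norms.L2Operator

variable {n : Type*} [Fintype n] [DecidableEq n]

/-- The spectral theorem for normal complex matrices. -/
theorem exists_unitary_conj_diagonal (A : Matrix n n ℂ) (hA : IsStarNormal A) :
    ∃ R ∈ unitary (Matrix n n ℂ), ∃ a : n → ℂ, A = R * diagonal a * star R := by
  have hfin : (spectrum ℂ A).Finite := A.finite_spectrum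
  have hcont (f : ℂ → ℂ) : ContinuousOn f (spectrum ℂ A) := hfin.continuousOn f
  obtain ⟨f, hf⟩ := Set.countable_iff_exists_injOn.1 hfin.countable
  set H : Matrix n n ℂ := cfc (fun z => (f z : ℂ)) A with hH
  have hHerm : H.IsHermitian := by
    change star H = H
    rw [hH, ← cfc_star]
    simp
  obtain ⟨q, hq⟩ := (hfin.image fun z => (f z : ℂ)).exists_polynomial_eval_eq
    (Function.invFunOn (fun z => (f z : ℂ)) (spectrum ℂ A))
  have hAq : A = aeval H q := by
    rw [hH, ← cfc_map_polynomial q _ A hA (hcont _)]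
    conv_lhs => rw [← cfc_id' ℂ A]
    refine cfc_congr fun z hz => ?_
    change z = q.eval (f z : ℂ)
    rw [hq _ (Set.mem_image_of_mem _ hz)]
    have hinj : Set.InjOn (fun z => (f z : ℂ)) (spectrum ℂ A) :=
      fun x hx y hy hxy => hf hx hy (Nat.cast_injective hxy)
    exact (hinj.leftInvOn_invFunOn hz).symm
  refine ⟨hHerm.eigenvectorUnitary, hHerm.eigenvectorUnitary.2,
    fun i => q.eval (hHerm.eigenvalues i : ℂ), ?_⟩
  have hdiag (d : n → ℂ) : aeval (diagonal d) q = diagonal fun i => q.eval (d i) := by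
    have := aeval_algHom_apply (diagonalAlgHom ℂ (α := ℂ) (n := n)) d q
    rw [diagonalAlgHom_apply, diagonalAlgHom_apply] at this
    rw [this]
    congr 1
    ext i
    simp [coe_aeval_eq_eval]
  refine (hAq.trans (congrArg (aeval · q) hHerm.spectral_theorem)).trans ?_
  have := aeval_algHom_apply
    (Unitary.conjStarAlgAut ℂ (Matrix n n ℂ) hHerm.eigenvectorUnitary).toAlgEquiv
    (diagonal (RCLike.ofReal ∘ hHerm.eigenvalues)) q
  refine this.trans ?_
  rw [hdiag]
  exact Unitary.conjStarAlgAut_apply (S := ℂ) _ _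

/-- The roots of the characteristic polynomial of a unitarily diagonalized matrix. -/
theorem roots_charpoly_unitary_conj_diagonal {R : Matrix n n ℂ}
    (hR : R ∈ unitary (Matrix n n ℂ)) (a : n → ℂ) :
    (R * diagonal a * star R).charpoly.roots = Finset.univ.val.map a := by
  have hinv : R⁻¹ = star R := inv_eq_left_inv hR.1
  have hchar : (R * diagonal a * R⁻¹).charpoly = (diagonal a).charpoly :=
    charpoly_units_conj ⟨R, star R, hR.2, hR.1⟩ _
  rw [← hinv, hchar, charpoly_diagonal]
  simpa only [Multiset.map_map] using! roots_multiset_prod_X_sub_C (Finset.univ.val.map a)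

/-- Normal complex matrices with equal characteristic polynomials are unitarily similar. -/
theorem exists_unitary_mul_eq_mul_of_charpoly_eq {A B : Matrix n n ℂ} (hA : IsStarNormal A)
    (hB : IsStarNormal B) (h : A.charpoly = B.charpoly) :
    ∃ P ∈ unitary (Matrix n n ℂ), P * B = A * P := by
  obtain ⟨R, hR, a, rfl⟩ := exists_unitary_conj_diagonal A hA
  obtain ⟨S, hS, b, rfl⟩ := exists_unitary_conj_diagonal B hB
  have hab := congrArg roots h
  rw [roots_charpoly_unitary_conj_diagonal hR, roots_charpoly_unitary_conj_diagonal hS] at hab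
  obtain ⟨σ, rfl⟩ := exists_perm_comp_eq_of_map_univ_eq a b hab
  have hRσ : R.submatrix id σ ∈ unitary (Matrix n n ℂ) := by
    have h1 : star (R.submatrix id σ) * R.submatrix id σ = 1 := by
      have h2 : star (R.submatrix id σ) * R.submatrix id σ = (star R * R).submatrix σ σ := rfl
      rw [h2, hR.1, submatrix_one_equiv]
    exact ⟨h1, mul_eq_one_comm.1 h1⟩
  have hd : R.submatrix id σ * diagonal (a ∘ σ) = (R * diagonal a).submatrix id σ := by
    ext i j
    simp [mul_diagonal]
  refine ⟨R.submatrix id σ * star S, mul_mem hRσ (Unitary.star_mem hS), ?_⟩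
  have hdR : R * diagonal a * star R * R.submatrix id σ = (R * diagonal a).submatrix id σ := by
    change (R * diagonal a * star R * R).submatrix id σ = _
    rw [mul_assoc, hR.1, mul_one]
  rw [← mul_assoc _ (R.submatrix id σ) (star S), hdR, ← hd]
  simp only [mul_assoc]
  rw [← mul_assoc (star S) S, hS.1, one_mul]

/-- A unitary complex matrix has a unitary square root that is a polynomial in it. -/
theorem exists_aeval_unitary_sq_eq {Y : Matrix n n ℂ} (hY : Y ∈ unitary (Matrix n n ℂ)) :
    ∃ p : ℂ[X], aeval Y p ∈ unitary (Matrix n n ℂ) ∧ aeval Y p * aeval Y p = Y := by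
  have hnorm : IsStarNormal Y := ⟨hY.1.trans hY.2.symm⟩
  obtain ⟨p, hp⟩ := Y.finite_spectrum.exists_polynomial_eval_eq fun z => z ^ (1 / 2 : ℂ)
  have hsq : ∀ z ∈ spectrum ℂ Y, p.eval z * p.eval z = z := fun z hz => by
    rw [hp z hz, ← sq]
    simp
  refine ⟨p, ?_, ?_⟩
  · rw [← cfc_polynomial p Y hnorm, cfc_unitary_iff _ Y hnorm]
    intro z hz
    have hz1 : ‖z‖ = 1 := by
      simpa only [mem_sphere_zero_iff_norm] using spectrum.subset_circle_of_unitary hY hz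
    have h1 : ‖p.eval z‖ = 1 := by
      have := congrArg norm (hsq z hz)
      rw [norm_mul, hz1] at this
      nlinarith [norm_nonneg (p.eval z)]
    rw [Complex.star_def, Complex.conj_mul', h1]
    simp
  · rw [← map_mul, ← cfc_polynomial _ Y hnorm]
    conv_rhs => rw [← cfc_id' ℂ Y]
    exact cfc_congr fun z hz => by simpa using hsq z hz

/-- If `Y` is self-adjoint for the bilinear form of `J`, so is every polynomial in `Y`. -/
theorem transpose_aeval_mul_eq {J Y : Matrix n n ℂ} (h : Yᵀ * J = J * Y) (p : ℂ[X]) :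
    (aeval Y p)ᵀ * J = J * aeval Y p := by
  induction p using Polynomial.induction_on' with
  | add p q hp hq => simp only [map_add, transpose_add, add_mul, mul_add, hp, hq]
  | monomial k c =>
    have hk : (Y ^ k)ᵀ * J = J * Y ^ k := by
      rw [transpose_pow]
      exact ((show SemiconjBy J Y Yᵀ from h.symm).pow_right k).symm
    rw [aeval_monomial, ← Algebra.smul_def, transpose_smul, smul_mul_assoc, hk, mul_smul_comm]

end Matrix

/-- The characteristic polynomial map on conjugacy classes of the unitary symplectic
group `USp(2g)` is injective: if `U, V` are `2g×2g` complex matrices, each unitary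
(`U⋆U = 1`) and symplectic (`Uᵀ·J·U = J`), with the same characteristic polynomial,
then `U` and `V` are conjugate by a unitary symplectic matrix `W`. -/
theorem usp_charpoly_injective_on_conj (g : ℕ) (hg : 1 ≤ g)
    (U V : Matrix (Fin g ⊕ Fin g) (Fin g ⊕ Fin g) ℂ)
    (hU₁ : star U * U = 1) (hU₂ : U.transpose * stdSymplJ g * U = stdSymplJ g)
    (hV₁ : star V * V = 1) (hV₂ : V.transpose * stdSymplJ g * V = stdSymplJ g)
    (hchar : U.charpoly = V.charpoly) :
    ∃ W : Matrix (Fin g ⊕ Fin g) (Fin g ⊕ Fin g) ℂ,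
      star W * W = 1 ∧ W.transpose * stdSymplJ g * W = stdSymplJ g ∧
      W⁻¹ * U * W = V := by
  set J := stdSymplJ g with hJ
  have hJJ : J * J = -1 := by
    rw [hJ, stdSymplJ, Matrix.fromBlocks_multiply, ← Matrix.fromBlocks_one, Matrix.fromBlocks_neg]
    simp
  have hJt : J.transpose = -J := by
    rw [hJ, stdSymplJ, Matrix.fromBlocks_transpose, Matrix.fromBlocks_neg]
    simp
  have hJstar : star J = -J := by
    rw [hJ, stdSymplJ, Matrix.star_eq_conjTranspose, Matrix.fromBlocks_conjTranspose,
      Matrix.fromBlocks_neg]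
    simp
  have hJu : J ∈ unitary (Matrix (Fin g ⊕ Fin g) (Fin g ⊕ Fin g) ℂ) := by
    simp [Unitary.mem_iff, hJstar, hJJ]
  have hV₁' : V * star V = 1 := mul_eq_one_comm.1 hV₁
  obtain ⟨P, hP, hPV⟩ := Matrix.exists_unitary_mul_eq_mul_of_charpoly_eq
    ⟨hU₁.trans (mul_eq_one_comm.1 hU₁).symm⟩ ⟨hV₁.trans hV₁'.symm⟩ hchar
  set S := P.transpose * J * P with hS
  have hPt : P.transpose ∈ unitary (Matrix (Fin g ⊕ Fin g) (Fin g ⊕ Fin g) ℂ) := by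
    have h1 : star P.transpose * P.transpose = 1 := by
      have : star P.transpose = (star P).transpose := rfl
      rw [this, ← Matrix.transpose_mul, hP.2, Matrix.transpose_one]
    exact ⟨h1, mul_eq_one_comm.1 h1⟩
  have hSt : S.transpose = -S := by
    simp [hS, Matrix.transpose_mul, hJt, mul_assoc]
  have hVSV : V.transpose * S * V = S := by
    calc V.transpose * S * V = (P * V).transpose * J * (P * V) := by
          simp only [hS, Matrix.transpose_mul, mul_assoc]
      _ = P.transpose * (U.transpose * J * U) * P := by
          rw [hPV]; simp only [Matrix.transpose_mul, mul_assoc]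
      _ = S := by rw [hU₂]
  set Y := -(J * S) with hY
  have hJY : J * Y = S := by
    rw [hY, mul_neg, ← mul_assoc, hJJ, neg_one_mul, neg_neg]
  have hYu : Y ∈ unitary (Matrix (Fin g ⊕ Fin g) (Fin g ⊕ Fin g) ℂ) := by
    have : Y = star J * (P.transpose * J * P) := by rw [hJstar, hY, neg_mul]
    rw [this]
    exact mul_mem (Unitary.star_mem hJu) (mul_mem (mul_mem hPt hJu) hP)
  have hYt : Y.transpose * J = J * Y := by
    rw [hJY, hY, Matrix.transpose_neg, Matrix.transpose_mul, hSt, hJt, neg_mul_neg, neg_mul,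
      mul_assoc, hJJ, mul_neg_one, neg_neg]
  have hVJ : V.transpose * J = J * star V := by
    rw [← mul_one (V.transpose * J), ← hV₁', ← mul_assoc, hV₂]
  have hcomm : Commute V Y := by
    have h1 : J * (star V * Y * V) = J * Y := by
      rw [hJY, ← hVSV, ← hJY, ← mul_assoc V.transpose, hVJ]
      simp only [mul_assoc]
    have h2 : star V * Y * V = Y := by
      have := congrArg (star J * ·) h1
      simpa only [← mul_assoc, hJu.1, one_mul] using this
    change V * Y = Y * V
    nth_rewrite 1 [← h2]
    rw [← mul_assoc, ← mul_assoc, hV₁', one_mul]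
  obtain ⟨p, hQu, hQQ⟩ := Matrix.exists_aeval_unitary_sq_eq hYu
  have hQt := Matrix.transpose_aeval_mul_eq hYt p
  have hQcomm : Commute V (Polynomial.aeval Y p) := by
    rw [Polynomial.aeval_eq_sum_range]
    exact Commute.sum_right _ _ _ fun i _ => (hcomm.pow_right i).smul_right _
  set Q := Polynomial.aeval Y p with hQ
  have hQst : (star Q).transpose * J = J * star Q := by
    have h3 : (star Q).transpose * Q.transpose = 1 := by
      rw [← Matrix.transpose_mul, hQu.2, Matrix.transpose_one]
    calc (star Q).transpose * J = (star Q).transpose * (J * Q) * star Q := by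
          rw [mul_assoc, mul_assoc J, hQu.2, mul_one]
      _ = J * star Q := by rw [← hQt, ← mul_assoc, h3, one_mul]
  have hQsV : star Q * V = V * star Q := by
    calc star Q * V = star Q * (V * Q) * star Q := by
          rw [mul_assoc, mul_assoc V, hQu.2, mul_one]
      _ = V * star Q := by rw [hQcomm.eq, ← mul_assoc, hQu.1, one_mul]
  have hW : P * star Q ∈ unitary (Matrix (Fin g ⊕ Fin g) (Fin g ⊕ Fin g) ℂ) :=
    mul_mem hP (Unitary.star_mem hQu)
  refine ⟨P * star Q, hW.1, ?_, ?_⟩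
  · calc (P * star Q).transpose * J * (P * star Q) = (star Q).transpose * S * star Q := by
          simp only [hS, Matrix.transpose_mul, mul_assoc]
      _ = J * (star Q * Q) * (Q * star Q) := by
          rw [← hJY, ← mul_assoc, hQst, ← hQQ]; simp only [mul_assoc]
      _ = J := by rw [hQu.1, hQu.2, mul_one, mul_one]
  · rw [Matrix.inv_eq_left_inv hW.1, mul_assoc, ← mul_assoc U, ← hPV, mul_assoc P, ← hQsV,
      ← mul_assoc P, ← mul_assoc, hW.1, one_mul]
end
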